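/- arXiv:1803.10568 — 7 statements merged into one kernel-verified Lean document; each statement's English description precedes it below -/
import Mathlib

section
/- Let X_i ~ Mult(n_i, u_i) independently for i = 1,…,L, where u_i = A_i p for given matrices A_i ∈ A(K_i, N) and a probability vector p ∈ R^N, and let α_i = n_i/n with n = Σ_i n_i. Let A be the (Σ_i K_i) × N matrix obtained by stacking the blocks α_1 A_1, …, α_L A_L, let X̄ be the stacked vector of the X_i, and assume A has rank N. Then the estimator p̂ := (1/n)(A'A)^{-1} A' X̄ has covariance matrix Var[p̂] = (1/n)(A'A)^{-1} ( Σ_{i=1}^{L} α_i^3 A_i' V(A_i p) A_i ) (A'A)^{-1}. -/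
open Matrix

/-- The probability mass function of the multinomial distribution `Mult(n, u)`:
the distribution of the vector of category counts of `n` i.i.d. categorical
random variables with probability vector `u`. -/
noncomputable def multinomialPMF {ι : Type*} [Fintype ι] (n : ℕ) (u : ι → ℝ)
    (x : ι → ℕ) : ℝ :=
  if (∑ i, x i) = n then
    (n.factorial : ℝ) / (∏ i, ((x i).factorial : ℝ)) * ∏ i, u i ^ x i
  else 0

/-- `V(u) = diag(u) − u u'`, the covariance matrix of one categorical draw with
probability vector `u` (so that `Mult(n,u)` has covariance `n V(u)`). -/
noncomputable def Vmat {ι : Type*} [Fintype ι] [DecidableEq ι] (u : ι → ℝ) :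
    Matrix ι ι ℝ :=
  Matrix.diagonal u - Matrix.vecMulVec u u

open Finset in
/-- A sum over all count vectors weighted by the multinomial mass function is a finite sum. -/
theorem tsum_multinomialPMF_mul {ι : Type*} [Fintype ι] [DecidableEq ι] (n : ℕ) (u : ι → ℝ)
    (f : (ι → ℕ) → ℝ) :
    ∑' x, multinomialPMF n u x * f x =
      ∑ x ∈ piAntidiag univ n, multinomialPMF n u x * f x := by
  refine tsum_eq_sum fun x hx => ?_
  have : ∑ i, x i ≠ n := by simpa using hx
  simp [multinomialPMF, this]

open Finset in
theorem sum_multinomialPMF {ι : Type*} [Fintype ι] [DecidableEq ι] (n : ℕ) (u : ι → ℝ)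
    (hu : ∑ i, u i = 1) : ∑ x ∈ piAntidiag univ n, multinomialPMF n u x = 1 := by
  have h := sum_pow_eq_sum_piAntidiag univ u n
  rw [hu, one_pow] at h
  rw [h]
  refine sum_congr rfl fun x hx => ?_
  have hx' : ∑ i, x i = n := by simpa using hx
  have hspec : ((∏ i, ((x i).factorial : ℝ)) * (Nat.multinomial univ x : ℝ)) = n.factorial := by
    rw [← hx']
    exact_mod_cast Nat.multinomial_spec univ x
  have hne : (∏ i, ((x i).factorial : ℝ)) ≠ 0 :=
    prod_ne_zero_iff.2 fun i _ => by exact_mod_cast (x i).factorial_ne_zero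
  rw [multinomialPMF, if_pos hx', ← hspec, mul_div_cancel_left₀ _ hne]

theorem succ_mul_multinomialPMF_add_single {ι : Type*} [Fintype ι] [DecidableEq ι] (n : ℕ)
    (u : ι → ℝ) (k : ι) (y : ι → ℕ) :
    ((y k : ℝ) + 1) * multinomialPMF (n + 1) u (y + Pi.single k 1) =
      (n + 1) * u k * multinomialPMF n u y := by
  have hsum : ∑ i, (y + Pi.single k 1 : ι → ℕ) i = (∑ i, y i) + 1 := by
    simp [Finset.sum_add_distrib]
  unfold multinomialPMF
  rw [hsum]
  by_cases h : ∑ i, y i = n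
  · rw [if_pos (by rw [h]), if_pos h]
    have hfac : ∏ i, (((y + Pi.single k 1 : ι → ℕ) i).factorial : ℝ) =
        ((y k : ℝ) + 1) * ∏ i, ((y i).factorial : ℝ) := by
      rw [← Finset.mul_prod_erase _ _ (Finset.mem_univ k),
        ← Finset.mul_prod_erase _ (fun i => ((y i).factorial : ℝ)) (Finset.mem_univ k)]
      rw [Finset.prod_congr rfl (g := fun i => ((y i).factorial : ℝ))]
      · simp [Nat.factorial_succ]; ring
      · intro i hi
        simp [Finset.ne_of_mem_erase hi]
    have hpow : ∏ i, u i ^ (y + Pi.single k 1 : ι → ℕ) i = u k * ∏ i, u i ^ y i := by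
      simp only [Pi.add_apply, pow_add, Finset.prod_mul_distrib]
      rw [mul_comm]
      congr 1
      rw [Finset.prod_eq_single k] <;> simp +contextual
    have hne : (∏ i, ((y i).factorial : ℝ)) ≠ 0 :=
      Finset.prod_ne_zero_iff.2 fun i _ => by exact_mod_cast (y i).factorial_ne_zero
    have hk : (y k : ℝ) + 1 ≠ 0 := by positivity
    rw [hfac, hpow, Nat.factorial_succ]
    push_cast
    field_simp
  · rw [if_neg (by omega), if_neg h]; simp

/-- Size-biasing identity for the multinomial distribution. -/
theorem tsum_multinomialPMF_mul_coord {ι : Type*} [Fintype ι] [DecidableEq ι] (n : ℕ)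
    (u : ι → ℝ) (k : ι) (g : (ι → ℕ) → ℝ) :
    ∑' x, multinomialPMF (n + 1) u x * (x k * g x) =
      (n + 1) * u k * ∑' y, multinomialPMF n u y * g (y + Pi.single k 1) := by
  rw [← Function.Injective.tsum_eq (add_left_injective (Pi.single k 1 : ι → ℕ)), ← tsum_mul_left]
  · refine tsum_congr fun y => ?_
    have h := succ_mul_multinomialPMF_add_single n u k y
    simp only [Pi.add_apply, Pi.single_eq_same, Nat.cast_add, Nat.cast_one]
    linear_combination g (y + Pi.single k 1) * h
  · intro x hx
    have hk : x k ≠ 0 := by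
      rintro h
      simp [h] at hx
    refine ⟨x - Pi.single k 1, ?_⟩
    ext i
    by_cases hi : i = k
    · subst hi
      simp
      omega
    · simp [hi]

open Finset in
theorem sum_multinomialPMF_mul_coord {ι : Type*} [Fintype ι] [DecidableEq ι] (n : ℕ)
    (u : ι → ℝ) (hu : ∑ i, u i = 1) (k : ι) :
    ∑ x ∈ piAntidiag univ n, multinomialPMF n u x * x k = n * u k := by
  rcases n with _ | n
  · simp
  · have h := tsum_multinomialPMF_mul_coord n u k fun _ => 1
    rw [tsum_multinomialPMF_mul, tsum_multinomialPMF_mul] at h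
    simpa [sum_multinomialPMF n u hu] using h

open Finset in
theorem sum_multinomialPMF_mul_coord_mul_coord {ι : Type*} [Fintype ι] [DecidableEq ι] (n : ℕ)
    (u : ι → ℝ) (hu : ∑ i, u i = 1) (k l : ι) :
    ∑ x ∈ piAntidiag univ n, multinomialPMF n u x * (x k * x l) =
      n * u k * ((n - 1) * u l + if k = l then 1 else 0) := by
  rcases n with _ | n
  · simp
  · have h := tsum_multinomialPMF_mul_coord n u k fun x => x l
    rw [tsum_multinomialPMF_mul, tsum_multinomialPMF_mul] at h
    rw [h]
    simp only [Pi.add_apply, Nat.cast_add, mul_add, sum_add_distrib, ← sum_mul,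
      sum_multinomialPMF_mul_coord n u hu, sum_multinomialPMF n u hu]
    by_cases hkl : k = l
    · subst hkl; simp
    · simp [hkl, Ne.symm hkl]

open Finset in
theorem sum_multinomialPMF_mul_centered {ι : Type*} [Fintype ι] [DecidableEq ι] (n : ℕ)
    (u : ι → ℝ) (hu : ∑ i, u i = 1) (k : ι) :
    ∑ x ∈ piAntidiag univ n, multinomialPMF n u x * (x k - n * u k) = 0 := by
  simp only [mul_sub, sum_sub_distrib, ← sum_mul, sum_multinomialPMF_mul_coord n u hu,
    sum_multinomialPMF n u hu]
  ring

open Finset in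
theorem sum_multinomialPMF_mul_centered_mul_centered {ι : Type*} [Fintype ι] [DecidableEq ι]
    (n : ℕ) (u : ι → ℝ) (hu : ∑ i, u i = 1) (k l : ι) :
    ∑ x ∈ piAntidiag univ n, multinomialPMF n u x * ((x k - n * u k) * (x l - n * u l)) =
      n * Vmat u k l := by
  have hexp : ∀ x : ι → ℕ,
      multinomialPMF n u x * (((x k : ℝ) - n * u k) * ((x l : ℝ) - n * u l)) =
      multinomialPMF n u x * (x k * x l) - multinomialPMF n u x * x k * (n * u l)
      - multinomialPMF n u x * x l * (n * u k)
      + multinomialPMF n u x * (n * u k * (n * u l)) := fun x => by ring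
  simp only [hexp, sum_sub_distrib, sum_add_distrib, ← sum_mul,
    sum_multinomialPMF_mul_coord n u hu, sum_multinomialPMF n u hu,
    sum_multinomialPMF_mul_coord_mul_coord n u hu]
  simp only [Vmat, Matrix.sub_apply, Matrix.diagonal_apply, Matrix.vecMulVec_apply]
  split_ifs <;> ring

open Finset in
/-- Covariance of linear functionals of a multinomial vector. -/
theorem sum_multinomialPMF_mul_linear_mul_linear {ι : Type*} [Fintype ι] [DecidableEq ι]
    (n : ℕ) (u : ι → ℝ) (hu : ∑ i, u i = 1) (a b : ι → ℝ) :
    ∑ x ∈ piAntidiag univ n, multinomialPMF n u x *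
        ((∑ k, a k * (x k - n * u k)) * ∑ k, b k * (x k - n * u k)) =
      n * ∑ k, ∑ l, a k * Vmat u k l * b l := by
  simp only [sum_mul_sum]
  simp only [mul_sum]
  rw [sum_comm]
  refine sum_congr rfl fun k _ => ?_
  rw [sum_comm]
  refine sum_congr rfl fun l _ => ?_
  have h := sum_multinomialPMF_mul_centered_mul_centered n u hu k l
  calc _ = a k * b l * ∑ x ∈ piAntidiag univ n,
        multinomialPMF n u x * ((x k - n * u k) * (x l - n * u l)) := by
        rw [mul_sum]
        exact sum_congr rfl fun x _ => by ring
    _ = _ := by rw [h]; ring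

open Finset in
theorem sum_multinomialPMF_mul_linear {ι : Type*} [Fintype ι] [DecidableEq ι]
    (n : ℕ) (u : ι → ℝ) (hu : ∑ i, u i = 1) (a : ι → ℝ) :
    ∑ x ∈ piAntidiag univ n, multinomialPMF n u x * ∑ k, a k * (x k - n * u k) = 0 := by
  simp only [mul_sum]
  rw [sum_comm]
  refine sum_eq_zero fun k _ => ?_
  simp only [mul_left_comm _ (a k), ← mul_sum, sum_multinomialPMF_mul_centered n u hu, mul_zero]

open Finset in
/-- Bienaymé's identity for covariances under a finite product of normalized weights. -/
theorem sum_piFinset_prod_mul_sum_mul_sum {I : Type*} [Fintype I] [DecidableEq I]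
    {κ : I → Type*} (t : ∀ i, Finset (κ i)) (w Y Z : ∀ i, κ i → ℝ)
    (hw : ∀ i, ∑ x ∈ t i, w i x = 1) (hY : ∀ i, ∑ x ∈ t i, w i x * Y i x = 0) :
    ∑ x ∈ Fintype.piFinset t, (∏ i, w i (x i)) * ((∑ i, Y i (x i)) * ∑ i, Z i (x i)) =
      ∑ i, ∑ x ∈ t i, w i x * (Y i x * Z i x) := by
  have key : ∀ i i', ∑ x ∈ Fintype.piFinset t, (∏ m, w m (x m)) * (Y i (x i) * Z i' (x i')) =
      if i = i' then ∑ x ∈ t i, w i x * (Y i x * Z i x) else 0 := by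
    intro i i'
    have hprod : ∀ x : ∀ i, κ i, (∏ m, w m (x m)) * (Y i (x i) * Z i' (x i')) =
        ∏ m, w m (x m) * ((if m = i then Y m (x m) else 1) * if m = i' then Z m (x m) else 1) := by
      intro x
      simp only [prod_mul_distrib]
      simp
    simp only [hprod]
    rw [← prod_univ_sum t fun m y =>
      w m y * ((if m = i then Y m y else 1) * if m = i' then Z m y else 1)]
    split_ifs with h
    · subst h
      rw [prod_eq_single i]
      · simp
      · intro m _ hm
        simp [hm, hw]
      · simp
    · refine prod_eq_zero (mem_univ i) ?_
      simp [h, hY]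
  simp only [sum_mul_sum]
  simp only [mul_sum]
  rw [sum_comm]
  refine sum_congr rfl fun i _ => ?_
  rw [sum_comm]
  simp [key]

theorem Matrix.isUnit_transpose_mul_self_of_rank {m n : Type*} [Fintype m] [Fintype n]
    [DecidableEq n] (A : Matrix m n ℝ) (h : A.rank = Fintype.card n) : IsUnit (Aᵀ * A) := by
  rw [← Matrix.mulVec_surjective_iff_isUnit]
  have : (Aᵀ * A).mulVecLin.range = ⊤ := by
    refine Submodule.eq_top_of_finrank_eq ?_
    rw [← Matrix.rank, Matrix.rank_transpose_mul_self, h, Module.finrank_fintype_fun_eq_card]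
  exact LinearMap.range_eq_top.1 this

/-- in the setting of Statement 0 (stacked independent multinomials,
`A` of rank `N`), the estimator `p̂ := (1/n)(A'A)⁻¹ A' X̄` has covariance matrix
`Var[p̂] = (1/n)(A'A)⁻¹ (Σ_i α_i³ A_i' V(A_i p) A_i) (A'A)⁻¹`. -/
theorem statement1 (L N : ℕ) (K : Fin L → ℕ)
    (Ai : ∀ i : Fin L, Matrix (Fin (K i)) (Fin N) ℝ)
    (hAi0 : ∀ i k j, 0 ≤ Ai i k j) (hAi1 : ∀ i j, ∑ k, Ai i k j = 1)
    (p : Fin N → ℝ) (hp0 : ∀ j, 0 ≤ p j) (hp1 : ∑ j, p j = 1)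
    (nn : Fin L → ℕ) (n : ℕ) (hn : n = ∑ i, nn i) (hnpos : 0 < n)
    (α : Fin L → ℝ) (hα : ∀ i, α i = (nn i : ℝ) / (n : ℝ))
    (A : Matrix ((i : Fin L) × Fin (K i)) (Fin N) ℝ)
    (hA : ∀ i k j, A ⟨i, k⟩ j = α i * Ai i k j)
    (hrank : A.rank = N)
    (phat : ((i : Fin L) → Fin (K i) → ℕ) → Fin N → ℝ)
    (hphat : ∀ x, phat x =
      (1 / (n : ℝ)) • ((Aᵀ * A)⁻¹ * Aᵀ).mulVec fun ik => (x ik.1 ik.2 : ℝ)) :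
    ∀ j l : Fin N,
      (∑' x : (i : Fin L) → Fin (K i) → ℕ,
          (∏ i, multinomialPMF (nn i) ((Ai i).mulVec p) (x i)) *
            ((phat x j - p j) * (phat x l - p l))) =
        ((1 / (n : ℝ)) •
            ((Aᵀ * A)⁻¹ *
              (∑ i, (α i) ^ 3 • ((Ai i)ᵀ * Vmat ((Ai i).mulVec p) * Ai i)) *
              (Aᵀ * A)⁻¹)) j l := by
  classical
  intro j l
  have hn0 : (n : ℝ) ≠ 0 := by exact_mod_cast hnpos.ne'
  set M := (Aᵀ * A)⁻¹ with hM
  set u : ∀ i, Fin (K i) → ℝ := fun i => (Ai i).mulVec p with hu_def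
  have hu : ∀ i, ∑ k, u i k = 1 := by
    intro i
    simp only [hu_def, Matrix.mulVec, dotProduct]
    rw [Finset.sum_comm]
    simp [← Finset.sum_mul, hAi1, hp1]
  have hunit : IsUnit (Aᵀ * A).det :=
    (Matrix.isUnit_iff_isUnit_det _).1 (A.isUnit_transpose_mul_self_of_rank (by simpa using hrank))
  have hMsymm : Mᵀ = M := by
    rw [hM, Matrix.transpose_nonsing_inv, Matrix.transpose_mul, Matrix.transpose_transpose]
  set G : ∀ i, Matrix (Fin N) (Fin (K i)) ℝ := fun i => M * (Ai i)ᵀ with hG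
  have hMA : ∀ a i k, (M * Aᵀ) a ⟨i, k⟩ = α i * G i a k := by
    intro a i k
    simp only [hG, Matrix.mul_apply, Matrix.transpose_apply, hA, Finset.mul_sum]
    exact Finset.sum_congr rfl fun _ _ => by ring
  have hnn : ∀ i, (nn i : ℝ) = n * α i := fun i => by rw [hα]; field_simp
  have hAp : ∀ i k, (A.mulVec p) ⟨i, k⟩ = α i * u i k := by
    intro i k
    simp only [hu_def, Matrix.mulVec, dotProduct, hA, Finset.mul_sum, mul_assoc]
  have hp : ∀ a, p a = ∑ i, ∑ k, α i * G i a k * (α i * u i k) := by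
    intro a
    have h1 : (M * Aᵀ).mulVec (A.mulVec p) = p := by
      rw [Matrix.mulVec_mulVec, Matrix.mul_assoc, hM, Matrix.nonsing_inv_mul _ hunit,
        Matrix.one_mulVec]
    conv_lhs => rw [← h1]
    rw [Matrix.mulVec, dotProduct, Fintype.sum_sigma]
    simp only [hMA, hAp]
  have hdev : ∀ x a, phat x a - p a =
      ∑ i, ∑ k, (1 / n * α i * G i a k) * (x i k - nn i * u i k) := by
    intro x a
    rw [hphat, hp a, Pi.smul_apply, Matrix.mulVec, dotProduct, Fintype.sum_sigma, smul_eq_mul,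
      Finset.mul_sum, ← Finset.sum_sub_distrib]
    refine Finset.sum_congr rfl fun i _ => ?_
    rw [Finset.mul_sum, ← Finset.sum_sub_distrib]
    refine Finset.sum_congr rfl fun k _ => ?_
    rw [hMA, hnn]
    field_simp
  rw [tsum_eq_sum (s := Fintype.piFinset fun i => Finset.piAntidiag Finset.univ (nn i))]
  · simp only [hdev]
    rw [sum_piFinset_prod_mul_sum_mul_sum _ (fun i => multinomialPMF (nn i) (u i))
      (fun i x => ∑ k, (1 / n * α i * G i j k) * (x k - nn i * u i k))
      (fun i x => ∑ k, (1 / n * α i * G i l k) * (x k - nn i * u i k))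
      (fun i => sum_multinomialPMF _ _ (hu i))
      (fun i => sum_multinomialPMF_mul_linear _ _ (hu i) _)]
    have hR : M * (∑ i, α i ^ 3 • ((Ai i)ᵀ * Vmat (u i) * Ai i)) * M =
        ∑ i, α i ^ 3 • (G i * Vmat (u i) * (G i)ᵀ) := by
      rw [Matrix.mul_sum, Matrix.sum_mul]
      refine Finset.sum_congr rfl fun i _ => ?_
      simp only [hG, Matrix.transpose_mul, Matrix.transpose_transpose, hMsymm, Matrix.mul_smul,
        Matrix.smul_mul, Matrix.mul_assoc]
    rw [hR, Matrix.smul_apply, Matrix.sum_apply, smul_eq_mul, Finset.mul_sum]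
    refine Finset.sum_congr rfl fun i _ => ?_
    rw [sum_multinomialPMF_mul_linear_mul_linear _ _ (hu i), hnn, Matrix.smul_apply, smul_eq_mul,
      Matrix.mul_apply]
    simp only [Matrix.mul_apply, Matrix.transpose_apply, Finset.sum_mul, Finset.mul_sum]
    rw [Finset.sum_comm]
    refine Finset.sum_congr rfl fun k _ => Finset.sum_congr rfl fun k' _ => ?_
    field_simp
  · intro x hx
    obtain ⟨i, hi⟩ : ∃ i, ∑ k, x i k ≠ nn i := by simpa using hx
    rw [Finset.prod_eq_zero (Finset.mem_univ i) (by simp [multinomialPMF, hi]), zero_mul]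
end

section
/- In the pair method with N ≥ 3 parties, the unbiased estimator p̂_i := ((N−1)/(N−2)) Σ_{j ≠ i} û_{{i,j}} − 1/(N−2), with û = X/n and X ~ Mult(n, A p), has variance Var[p̂_i] = (1/n)( (1 + (N−3) p_i)/(N−2) − p_i^2 ) for every i = 1,…,N. -/
open Matrix

/-- The index type of unordered pairs of distinct parties (the possible responses in
the pair method), realized as two-element subsets of `Fin N`. -/
abbrev PairIdx (N : ℕ) := {s : Finset (Fin N) // s.card = 2}

/-- In the pair method the probability of the response `{i,j}` is
`u_{ij} = (p_i + p_j)/(N−1)`. -/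
noncomputable def pairU (N : ℕ) (p : Fin N → ℝ) (s : PairIdx N) : ℝ :=
  (∑ k ∈ s.1, p k) / ((N : ℝ) - 1)

/-- The pair-method estimator `p̂_i = ((N−1)/(N−2)) Σ_{j≠i} û_{{i,j}} − 1/(N−2)`,
where `û = X/n` and the sum runs over all pairs containing `i`. -/
noncomputable def pairPhat (N : ℕ) (n : ℕ) (x : PairIdx N → ℕ) (i : Fin N) : ℝ :=
  ((N : ℝ) - 1) / ((N : ℝ) - 2) *
      (∑ s : PairIdx N, if i ∈ s.1 then (x s : ℝ) / (n : ℝ) else 0) -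
    1 / ((N : ℝ) - 2)


open Polynomial in
/-- The probability generating polynomial of the total count falling in a set `A` of categories. -/
lemma sum_multinomialPMF_mul_X_pow {ι : Type*} [Fintype ι] [DecidableEq ι] (n : ℕ) (u : ι → ℝ)
    (A : Finset ι) :
    ∑ x ∈ Finset.piAntidiag Finset.univ n,
        C (multinomialPMF n u x) * (X : ℝ[X]) ^ (∑ i ∈ A, x i) =
      (C (∑ i ∈ A, u i) * X + C (∑ i ∈ Aᶜ, u i)) ^ n := by
  have hsplit : C (∑ i ∈ A, u i) * X + C (∑ i ∈ Aᶜ, u i) =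
      ∑ i, C (u i) * (if i ∈ A then (X : ℝ[X]) else 1) := by
    rw [← Finset.sum_add_sum_compl A, map_sum, map_sum, Finset.sum_mul]
    congr 1
    · exact Finset.sum_congr rfl fun i hi => by simp [hi]
    · exact Finset.sum_congr rfl fun i hi => by simp [Finset.mem_compl.mp hi]
  rw [hsplit, Finset.sum_pow_eq_sum_piAntidiag]
  refine Finset.sum_congr rfl fun x hx => ?_
  have hx : ∑ i, x i = n := (Finset.mem_piAntidiag.mp hx).1
  have hcoef : multinomialPMF n u x =
      (Nat.multinomial Finset.univ x : ℝ) * ∏ i, u i ^ x i := by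
    have hspec : (∏ i, ((x i).factorial : ℝ)) * Nat.multinomial Finset.univ x = n.factorial := by
      rw [← hx]
      exact_mod_cast Nat.multinomial_spec Finset.univ x
    have hne : (∏ i, ((x i).factorial : ℝ)) ≠ 0 :=
      Finset.prod_ne_zero_iff.mpr fun i _ => by positivity
    rw [multinomialPMF, if_pos hx, ← hspec, mul_div_cancel_left₀ _ hne]
  have hX : ∏ i, (if i ∈ A then (X : ℝ[X]) else 1) ^ x i = X ^ (∑ i ∈ A, x i) := by
    simp [ite_pow, Finset.prod_ite_mem, Finset.prod_pow_eq_pow_sum]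
  simp only [mul_pow, Finset.prod_mul_distrib]
  rw [hX, hcoef]
  simp [map_prod, mul_assoc]

open Polynomial in
/-- The total count falling in a set of categories has the variance of a binomial variable. -/
lemma tsum_multinomialPMF_mul_sq {ι : Type*} [Fintype ι] [DecidableEq ι] (n : ℕ) (u : ι → ℝ)
    (hu : ∑ i, u i = 1) (A : Finset ι) :
    ∑' x : ι → ℕ, multinomialPMF n u x * ((∑ i ∈ A, (x i : ℝ)) - n * ∑ i ∈ A, u i) ^ 2 =
      n * (∑ i ∈ A, u i) * (1 - ∑ i ∈ A, u i) := by
  rw [tsum_eq_sum (s := Finset.piAntidiag Finset.univ n)]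
  swap
  · intro x hx
    have : ¬ ∑ i, x i = n := fun h => hx (by simp [h])
    simp [multinomialPMF, this]
  have hgen := sum_multinomialPMF_mul_X_pow n u A
  have hcompl : ∑ i ∈ Aᶜ, u i = 1 - ∑ i ∈ A, u i := by
    rw [← hu, ← Finset.sum_add_sum_compl A]; ring
  rw [hcompl] at hgen
  set q := ∑ i ∈ A, u i
  have hmean : ∑ x ∈ Finset.piAntidiag Finset.univ n,
      multinomialPMF n u x * ∑ i ∈ A, (x i : ℝ) = n * q := by
    simpa [eval_finsetSum, derivative_pow] using
      congrArg (fun P => eval 1 (derivative P)) hgen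
  have hsq : ∑ x ∈ Finset.piAntidiag Finset.univ n,
      multinomialPMF n u x * (∑ i ∈ A, (x i : ℝ)) ^ 2 = n * q * (1 - q) + (n * q) ^ 2 := by
    have h := congrArg (fun P => eval 1 (derivative (X * derivative P))) hgen
    simp [eval_finsetSum, derivative_pow] at h
    have hpred (k : ℕ) : (k : ℝ) * ((k - 1 : ℕ) : ℝ) = (k : ℝ) ^ 2 - k := by
      cases k <;> simp; ring
    have hpow (x : ι → ℕ) : multinomialPMF n u x * (∑ i ∈ A, (x i : ℝ)) ^ 2 =
        multinomialPMF n u x * ∑ i ∈ A, (x i : ℝ) +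
          multinomialPMF n u x * ((∑ i ∈ A, (x i : ℝ)) * ((∑ i ∈ A, x i - 1 : ℕ) : ℝ)) := by
      have := hpred (∑ i ∈ A, x i)
      push_cast at this
      rw [this]
      ring
    rw [Finset.sum_congr rfl fun x _ => hpow x, Finset.sum_add_distrib, h]
    linear_combination q ^ 2 * hpred n
  have htotal : ∑ x ∈ Finset.piAntidiag Finset.univ n, multinomialPMF n u x = 1 := by
    simpa [eval_finsetSum] using congrArg (eval 1) hgen
  calc ∑ x ∈ Finset.piAntidiag Finset.univ n,
        multinomialPMF n u x * ((∑ i ∈ A, (x i : ℝ)) - n * q) ^ 2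
      = ∑ x ∈ Finset.piAntidiag Finset.univ n,
          (multinomialPMF n u x * (∑ i ∈ A, (x i : ℝ)) ^ 2 -
            2 * (n * q) * (multinomialPMF n u x * ∑ i ∈ A, (x i : ℝ)) +
            (n * q) ^ 2 * multinomialPMF n u x) :=
        Finset.sum_congr rfl fun x _ => by ring
    _ = n * q * (1 - q) := by
        rw [Finset.sum_add_distrib, Finset.sum_sub_distrib, ← Finset.mul_sum, ← Finset.mul_sum,
          hmean, hsq, htotal]
        ring

/-- Summing over the pairs containing `i` amounts to summing over the other party. -/
lemma sum_pairIdx_mem {N : ℕ} (i : Fin N) (f : Finset (Fin N) → ℝ) :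
    ∑ s : PairIdx N with i ∈ s.1, f s.1 = ∑ j ∈ Finset.univ.erase i, f {i, j} := by
  symm
  refine Finset.sum_bij (fun j hj => ⟨{i, j}, Finset.card_pair (Finset.ne_of_mem_erase hj).symm⟩)
    ?_ ?_ ?_ ?_
  · simp
  · intro j hj k hk h
    have hjk : j ∈ ({i, k} : Finset (Fin N)) := by
      rw [← Subtype.mk.inj h]; simp
    simpa [Finset.ne_of_mem_erase hj] using hjk
  · rintro ⟨s, hs⟩ his
    obtain ⟨a, b, hab, rfl⟩ := Finset.card_eq_two.mp hs
    have his : i = a ∨ i = b := by simpa using his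
    rcases his with rfl | rfl
    · exact ⟨b, by simp [hab.symm], rfl⟩
    · exact ⟨a, by simp [hab], Subtype.ext (Finset.pair_comm _ _)⟩
  · simp

lemma sum_pairU_mem {N : ℕ} (hN : 3 ≤ N) (p : Fin N → ℝ) (hp : ∑ i, p i = 1) (i : Fin N) :
    ∑ s : PairIdx N with i ∈ s.1, pairU N p s = (((N : ℝ) - 2) * p i + 1) / ((N : ℝ) - 1) := by
  have hN1 : 1 ≤ N := by omega
  simp only [pairU]
  rw [← Finset.sum_div, sum_pairIdx_mem i (fun s => ∑ k ∈ s, p k)]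
  congr 1
  calc ∑ j ∈ Finset.univ.erase i, ∑ k ∈ {i, j}, p k
      = ∑ j ∈ Finset.univ.erase i, (p i + p j) :=
        Finset.sum_congr rfl fun j hj => Finset.sum_pair (Finset.ne_of_mem_erase hj).symm
    _ = ((N : ℝ) - 2) * p i + 1 := by
        have h := Finset.add_sum_erase Finset.univ p (Finset.mem_univ i)
        rw [Finset.sum_add_distrib, Finset.sum_const, Finset.card_erase_of_mem (Finset.mem_univ i),
          Finset.card_univ, Fintype.card_fin, nsmul_eq_mul, Nat.cast_sub hN1]
        push_cast
        linarith

lemma sum_pairU {N : ℕ} (hN : 3 ≤ N) (p : Fin N → ℝ) (hp : ∑ i, p i = 1) :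
    ∑ s : PairIdx N, pairU N p s = 1 := by
  have hN1 : 1 ≤ N := by omega
  have hN' : (3 : ℝ) ≤ N := by exact_mod_cast hN
  have hne : (N : ℝ) - 1 ≠ 0 := by linarith
  simp only [pairU]
  rw [← Finset.sum_div, div_eq_one_iff_eq hne]
  calc ∑ s : PairIdx N, ∑ k ∈ s.1, p k
      = ∑ s : PairIdx N, ∑ k, if k ∈ s.1 then p k else 0 := by simp
    _ = ∑ k, ∑ s : PairIdx N with k ∈ s.1, p k := by
        rw [Finset.sum_comm]
        simp only [Finset.sum_filter]
    _ = ∑ k, ((N : ℝ) - 1) * p k := by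
        refine Finset.sum_congr rfl fun k _ => ?_
        rw [sum_pairIdx_mem k (fun _ => p k), Finset.sum_const,
          Finset.card_erase_of_mem (Finset.mem_univ k), Finset.card_univ, Fintype.card_fin,
          nsmul_eq_mul, Nat.cast_sub hN1, Nat.cast_one]
    _ = (N : ℝ) - 1 := by rw [← Finset.mul_sum, hp, mul_one]

/-- in the pair method with `N ≥ 3` parties, the unbiased estimator `p̂_i`
has variance `Var[p̂_i] = (1/n)((1 + (N−3)p_i)/(N−2) − p_i²)` for every `i`. -/
theorem statement5 (N : ℕ) (hN : 3 ≤ N) (p : Fin N → ℝ)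
    (hp0 : ∀ i, 0 ≤ p i) (hp1 : ∑ i, p i = 1) (n : ℕ) (hn : 0 < n) :
    ∀ i : Fin N,
      (∑' x : PairIdx N → ℕ,
          multinomialPMF n (pairU N p) x * (pairPhat N n x i - p i) ^ 2) =
        (1 / (n : ℝ)) * ((1 + ((N : ℝ) - 3) * p i) / ((N : ℝ) - 2) - p i ^ 2) := by
  intro i
  have hN' : (3 : ℝ) ≤ N := by exact_mod_cast hN
  have hN1 : (N : ℝ) - 1 ≠ 0 := by linarith
  have hN2 : (N : ℝ) - 2 ≠ 0 := by linarith
  have hn' : (n : ℝ) ≠ 0 := by exact_mod_cast hn.ne'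
  set A : Finset (PairIdx N) := Finset.univ.filter (fun s => i ∈ s.1)
  have hq := sum_pairU_mem hN p hp1 i
  have hvar := tsum_multinomialPMF_mul_sq n (pairU N p) (sum_pairU hN p hp1) A
  rw [hq] at hvar
  have hdev (x : PairIdx N → ℕ) : multinomialPMF n (pairU N p) x * (pairPhat N n x i - p i) ^ 2 =
      (((N : ℝ) - 1) / (((N : ℝ) - 2) * n)) ^ 2 * (multinomialPMF n (pairU N p) x *
        ((∑ s ∈ A, (x s : ℝ)) - n * ((((N : ℝ) - 2) * p i + 1) / ((N : ℝ) - 1))) ^ 2) := by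
    rw [pairPhat, ← Finset.sum_filter, ← Finset.sum_div]
    field_simp
    ring
  simp only [hdev]
  rw [tsum_mul_left, hvar]
  field_simp
  ring
end

section
/- Let N = 2M be even and consider the list method using the set of all L = C(N−1, M−1) lists of M parties that contain party one, together with their complementary lists of M parties each (so that the lists and complementary lists cover all C(N, M) subsets of size N/2). Assume α_l = 1/L for all l. Then in the estimator p̂ = (1/n)(A'A)^{-1} A' X̄ of Lemma 1, all coordinates p̂_i have the same variance, and this common variance equals (4/(nL)) (1 − 1/N)^2 Σ_{l=1}^{L} p_l^+ p_l^−, where p_l^+ and p_l^− are the total probabilities of the parties on list l and on its complementary list respectively. -/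
open Matrix

/-- For `N = 2M`, the index type of the balanced list design: all lists
(subsets of the `N` parties) of size `M` that contain party one. -/
abbrev ListIdx (M : ℕ) (hM : 0 < M) :=
  {s : Finset (Fin (2 * M)) // s.card = M ∧ (⟨0, by omega⟩ : Fin (2 * M)) ∈ s}

/-- The stacked design matrix of the balanced list design with equal weights
`α_l = 1/L`: for each list `l`, the block `α_l A_l` where the first row of `A_l`
indicates membership in the list `𝔏_l⁺` and the second row indicates membership in
the complementary list `𝔏_l⁻`. -/
noncomputable def listA (M : ℕ) (hM : 0 < M) :
    Matrix (ListIdx M hM × Fin 2) (Fin (2 * M)) ℝ :=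
  Matrix.of fun lb j =>
    (1 / (Fintype.card (ListIdx M hM) : ℝ)) *
      (if lb.2 = 0 then (if j ∈ lb.1.1 then 1 else 0) else (if j ∈ lb.1.1 then 0 else 1))

/-- The response probabilities for list `l`: a yes-answer has probability
`p_l⁺ = Σ_{k ∈ 𝔏_l⁺} p_k` and a no-answer probability `p_l⁻ = Σ_{k ∈ 𝔏_l⁻} p_k`. -/
noncomputable def listU (M : ℕ) (hM : 0 < M) (p : Fin (2 * M) → ℝ) (l : ListIdx M hM) :
    Fin 2 → ℝ :=
  fun b => if b = 0 then ∑ k ∈ l.1, p k else ∑ k ∈ l.1ᶜ, p k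

/-- The list-method estimator `p̂ = (1/n)(A'A)⁻¹ A' X̄` of Lemma 1, applied to the
stacked yes/no counts `x`. -/
noncomputable def listPhat (M : ℕ) (hM : 0 < M) (n : ℕ)
    (x : ListIdx M hM → Fin 2 → ℕ) : Fin (2 * M) → ℝ :=
  (1 / (n : ℝ)) •
    (((listA M hM)ᵀ * listA M hM)⁻¹ * (listA M hM)ᵀ).mulVec fun lb => (x lb.1 lb.2 : ℝ)

open Finset in
/-- The second moment of a sum of independent centred variables, for finitely supported weights,
is the sum of the individual second moments. -/
lemma sum_piFinset_prod_mul_sq_sum {ι α : Type*} [Fintype ι] [DecidableEq ι] [DecidableEq α]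
    (t : ι → Finset α) (w f : ι → α → ℝ) (V : ι → ℝ)
    (hw : ∀ l, ∑ a ∈ t l, w l a = 1) (hf : ∀ l, ∑ a ∈ t l, w l a * f l a = 0)
    (hV : ∀ l, ∑ a ∈ t l, w l a * f l a ^ 2 = V l) :
    ∑ x ∈ Fintype.piFinset t, (∏ l, w l (x l)) * (∑ l, f l (x l)) ^ 2 = ∑ l, V l := by
  have key : ∀ l l' : ι, ∑ x ∈ Fintype.piFinset t, (∏ k, w k (x k)) * (f l (x l) * f l' (x l'))
      = if l = l' then V l else 0 := by
    intro l l'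
    have h1 : ∀ x : ι → α, (∏ k, w k (x k)) * (f l (x l) * f l' (x l')) =
        ∏ k, (w k (x k) * ((if l = k then f k (x k) else 1) *
          (if l' = k then f k (x k) else 1))) := by
      intro x
      rw [prod_mul_distrib, prod_mul_distrib, prod_ite_eq, prod_ite_eq]
      simp
    simp_rw [h1]
    rw [← prod_univ_sum t fun k a => w k a * ((if l = k then f k a else 1) *
      (if l' = k then f k a else 1))]
    split_ifs with h
    · subst h
      rw [prod_eq_single l]
      · simp [← hV l, sq]
      · intro k _ hk
        simp [hk.symm, hw]
      · simp
    · apply prod_eq_zero (mem_univ l)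
      simp [Ne.symm h, hf]
  calc _ = ∑ x ∈ Fintype.piFinset t, ∑ l, ∑ l',
        (∏ k, w k (x k)) * (f l (x l) * f l' (x l')) := by
        refine sum_congr rfl fun x _ => ?_
        rw [sq, sum_mul_sum, mul_sum]
        simp_rw [mul_sum]
    _ = ∑ l, ∑ l', ∑ x ∈ Fintype.piFinset t, (∏ k, w k (x k)) * (f l (x l) * f l' (x l')) := by
        rw [sum_comm]
        exact sum_congr rfl fun l _ => sum_comm
    _ = _ := by simp [key]

open Finset in
/-- Summing against a two-category multinomial distribution is summing against Bernstein
polynomials. -/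
lemma sum_antidiagonalTuple_two_multinomialPMF (m : ℕ) (u : Fin 2 → ℝ) (hu : u 0 + u 1 = 1)
    (g : ℕ → ℝ) :
    ∑ x ∈ Finset.Nat.antidiagonalTuple 2 m, multinomialPMF m u x * g (x 0) =
      ∑ k ∈ range (m + 1), (bernsteinPolynomial ℝ m k).eval (u 0) * g k := by
  have h1 : 1 - u 0 = u 1 := by linarith
  rw [Finset.Nat.antidiagonalTuple_two, sum_map,
    Finset.Nat.sum_antidiagonal_eq_sum_range_succ_mk]
  refine sum_congr rfl fun k hk => ?_
  have hk : k ≤ m := by simpa [Nat.lt_succ_iff] using hk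
  simp [multinomialPMF, bernsteinPolynomial, hk, h1, Nat.cast_choose ℝ hk, mul_assoc]

open Finset in
lemma sum_multinomialPMF_two (m : ℕ) (u : Fin 2 → ℝ) (hu : u 0 + u 1 = 1) :
    ∑ x ∈ Finset.Nat.antidiagonalTuple 2 m, multinomialPMF m u x = 1 := by
  have := sum_antidiagonalTuple_two_multinomialPMF m u hu fun _ => 1
  have h := congrArg (Polynomial.eval (u 0)) (bernsteinPolynomial.sum ℝ m)
  simp only [Polynomial.eval_finsetSum, Polynomial.eval_one] at h
  simpa [h] using this

open Finset in
lemma sum_multinomialPMF_two_mul_sub (m : ℕ) (u : Fin 2 → ℝ) (hu : u 0 + u 1 = 1) :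
    ∑ x ∈ Finset.Nat.antidiagonalTuple 2 m, multinomialPMF m u x * ((x 0 : ℝ) - m * u 0) = 0 := by
  rw [sum_antidiagonalTuple_two_multinomialPMF m u hu fun k => (k : ℝ) - m * u 0]
  have h := congrArg (Polynomial.eval (u 0)) (bernsteinPolynomial.sum ℝ m)
  have h' := congrArg (Polynomial.eval (u 0)) (bernsteinPolynomial.sum_smul ℝ m)
  simp [Polynomial.eval_finsetSum] at h h'
  simp_rw [mul_sub, sum_sub_distrib, ← sum_mul, h, mul_comm _ ((_ : ℕ) : ℝ), h']
  ring

open Finset in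
lemma sum_multinomialPMF_two_mul_sub_sq (m : ℕ) (u : Fin 2 → ℝ) (hu : u 0 + u 1 = 1) :
    ∑ x ∈ Finset.Nat.antidiagonalTuple 2 m,
      multinomialPMF m u x * ((x 0 : ℝ) - m * u 0) ^ 2 = m * (u 0 * u 1) := by
  rw [sum_antidiagonalTuple_two_multinomialPMF m u hu fun k => ((k : ℝ) - m * u 0) ^ 2]
  have h := congrArg (Polynomial.eval (u 0)) (bernsteinPolynomial.variance ℝ m)
  simp [Polynomial.eval_finsetSum] at h
  have h1 : u 1 = 1 - u 0 := by linarith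
  rw [h1, ← mul_assoc, ← h]
  refine sum_congr rfl fun k _ => ?_
  ring

open Finset in
/-- Summing a complement-invariant function over half of the balanced splits. -/
lemma two_mul_sum_listIdx (M : ℕ) (hM : 0 < M) (F : Finset (Fin (2 * M)) → ℝ)
    (hF : ∀ s, F sᶜ = F s) :
    2 * ∑ l : ListIdx M hM, F l.1 = ∑ s ∈ powersetCard M univ, F s := by
  set z : Fin (2 * M) := ⟨0, by omega⟩ with hz
  have h1 : ∑ l : ListIdx M hM, F l.1 =
      ∑ s ∈ (powersetCard M (univ : Finset (Fin (2 * M)))).filter (z ∈ ·), F s :=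
    (sum_subtype _ (by simp [mem_powersetCard, hz]) F).symm
  rw [← sum_filter_add_sum_filter_not (powersetCard M univ) (z ∈ ·), h1, two_mul]
  congr 1
  refine sum_nbij' (fun s => sᶜ) (fun s => sᶜ) ?_ ?_ (by simp) (by simp) (by simp [hF])
  all_goals
    intro s
    simp only [mem_filter, mem_powersetCard, subset_univ, true_and, mem_compl, not_not,
      card_compl, Fintype.card_fin]
    rintro ⟨h, h'⟩
    exact ⟨by omega, h'⟩

open Finset in
/-- In a balanced split, exactly half of the parties are on the same side as a given one. -/
lemma sum_sameSide (M : ℕ) (s : Finset (Fin (2 * M))) (hs : s.card = M) (j : Fin (2 * M)) :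
    ∑ k, (if (j ∈ s ↔ k ∈ s) then (1 : ℝ) else 0) = M := by
  by_cases h : j ∈ s
  · simp [h, hs]
  · have hs' : univ.filter (fun k => (j ∈ s ↔ k ∈ s)) = sᶜ := by ext; simp [h]
    have hc : sᶜ.card = M := by rw [card_compl, hs, Fintype.card_fin]; omega
    rw [sum_boole, hs', hc]

open Finset in
lemma sum_listIdx_sameSide_of_ne (M : ℕ) (hM : 0 < M) {j k : Fin (2 * M)} (hjk : j ≠ k) :
    (2 * (M : ℝ) - 1) * ∑ l : ListIdx M hM, (if (j ∈ l.1 ↔ k ∈ l.1) then (1 : ℝ) else 0) =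
      Fintype.card (ListIdx M hM) * ((M : ℝ) - 1) := by
  set G : Fin (2 * M) → ℝ := fun k =>
    ∑ l : ListIdx M hM, (if (j ∈ l.1 ↔ k ∈ l.1) then (1 : ℝ) else 0) with hG
  have hconst : ∀ k', k' ≠ j → G k' = G k := by
    intro k' hk'
    have h2 : ∀ k, 2 * G k = ∑ s ∈ powersetCard M univ,
        (if (j ∈ s ↔ k ∈ s) then (1 : ℝ) else 0) := fun k =>
      two_mul_sum_listIdx M hM (fun s => if (j ∈ s ↔ k ∈ s) then (1 : ℝ) else 0)
        (by intro s; simp only [mem_compl, not_iff_not])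
    have h3 : 2 * G k' = 2 * G k := by
      rw [h2, h2]
      have hj : Equiv.swap k k' j = j := Equiv.swap_apply_of_ne_of_ne hjk hk'.symm
      refine sum_nbij' (fun s => s.map (Equiv.swap k k').toEmbedding)
        (fun s => s.map (Equiv.swap k k').toEmbedding) ?_ ?_ ?_ ?_ ?_
      · intro s; simp [mem_powersetCard]
      · intro s; simp [mem_powersetCard]
      · intro s _; ext a; simp [mem_map_equiv]
      · intro s _; ext a; simp [mem_map_equiv]
      · intro s _
        simp [mem_map_equiv, hj]
    linarith
  have hself : G j = Fintype.card (ListIdx M hM) := by simp [hG]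
  have hrow : ∑ k, G k = Fintype.card (ListIdx M hM) * M := by
    rw [hG, sum_comm, sum_congr rfl fun l _ => sum_sameSide M l.1 l.2.1 j]
    simp
  rw [← add_sum_erase _ _ (mem_univ j), hself,
    sum_congr rfl fun k' hk' => hconst k' (ne_of_mem_erase hk'), sum_const,
    card_erase_of_mem (mem_univ j), nsmul_eq_mul] at hrow
  have hc : ((univ : Finset (Fin (2 * M))).card - 1 : ℕ) = (2 * (M : ℝ) - 1) := by
    rw [card_univ, Fintype.card_fin, Nat.cast_sub (by omega)]; push_cast; ring
  rw [hc] at hrow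
  linarith

/-- The Gram matrix of the balanced list design is a combination of the identity and the
all-ones matrix. -/
lemma listA_gram (M : ℕ) (hM : 0 < M) (hL : 0 < Fintype.card (ListIdx M hM)) :
    (listA M hM)ᵀ * listA M hM =
      ((M : ℝ) / ((2 * M - 1) * Fintype.card (ListIdx M hM))) • (1 : Matrix _ _ ℝ) +
      (((M : ℝ) - 1) / ((2 * M - 1) * Fintype.card (ListIdx M hM))) •
        Matrix.of (fun _ _ => (1 : ℝ)) := by
  have hL' : (0 : ℝ) < Fintype.card (ListIdx M hM) := by exact_mod_cast hL
  have hM' : (1 : ℝ) ≤ M := by exact_mod_cast hM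
  have hd : (2 * (M : ℝ) - 1) ≠ 0 := by linarith
  ext j k
  have h1 : ((listA M hM)ᵀ * listA M hM) j k = (1 / (Fintype.card (ListIdx M hM) : ℝ)) ^ 2 *
      ∑ l : ListIdx M hM, (if (j ∈ l.1 ↔ k ∈ l.1) then (1 : ℝ) else 0) := by
    rw [Matrix.mul_apply, Fintype.sum_prod_type, Finset.mul_sum]
    refine Finset.sum_congr rfl fun l _ => ?_
    by_cases hj : j ∈ l.1 <;> by_cases hk : k ∈ l.1 <;> simp [listA, hj, hk, sq]
  rw [h1]
  by_cases hjk : j = k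
  · subst hjk
    have hd' : (M : ℝ) / ((2 * M - 1) * Fintype.card (ListIdx M hM)) +
        ((M : ℝ) - 1) / ((2 * M - 1) * Fintype.card (ListIdx M hM)) =
        1 / Fintype.card (ListIdx M hM) := by
      rw [← add_div, div_eq_div_iff (by positivity) (by positivity)]
      ring
    simp [hd', sq]
    field_simp
  · have h2 := sum_listIdx_sameSide_of_ne M hM hjk
    rw [mul_comm, ← eq_div_iff hd] at h2
    rw [h2]
    simp [hjk]
    field_simp

lemma isUnit_det_listA_gram (M : ℕ) (hM : 0 < M) (hL : 0 < Fintype.card (ListIdx M hM)) :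
    IsUnit ((listA M hM)ᵀ * listA M hM).det := by
  have hL' : (0 : ℝ) < Fintype.card (ListIdx M hM) := by exact_mod_cast hL
  have hM' : (1 : ℝ) ≤ M := by exact_mod_cast hM
  have hd : 0 < (2 * (M : ℝ) - 1) := by linarith
  rw [listA_gram M hM hL]
  have hJ : (Matrix.of (fun _ _ => (1 : ℝ)) : Matrix (Fin (2 * M)) (Fin (2 * M)) ℝ).PosSemidef := by
    have := Matrix.posSemidef_vecMulVec_self_star (fun _ : Fin (2 * M) => (1 : ℝ))
    convert this using 1
    ext
    simp [Matrix.vecMulVec_apply]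
  have hpd := (Matrix.PosDef.one (n := Fin (2 * M)) (R := ℝ)).smul
    (show (0 : ℝ) < (M : ℝ) / ((2 * M - 1) * Fintype.card (ListIdx M hM)) by positivity)
  have := hpd.add_posSemidef (hJ.smul
    (show (0 : ℝ) ≤ ((M : ℝ) - 1) / ((2 * M - 1) * Fintype.card (ListIdx M hM)) from
      div_nonneg (by linarith) (by positivity)))
  exact (Matrix.isUnit_iff_isUnit_det _).1 this.isUnit

/-- On vectors with coordinate sum zero, the inverse Gram matrix acts as a scalar. -/
lemma listA_gram_inv_mulVec (M : ℕ) (hM : 0 < M) (hL : 0 < Fintype.card (ListIdx M hM))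
    (v : Fin (2 * M) → ℝ) (hv : ∑ j, v j = 0) :
    ((listA M hM)ᵀ * listA M hM)⁻¹ *ᵥ v =
      ((2 * M - 1) * Fintype.card (ListIdx M hM) / (M : ℝ)) • v := by
  have hL' : (0 : ℝ) < Fintype.card (ListIdx M hM) := by exact_mod_cast hL
  have hM' : (1 : ℝ) ≤ M := by exact_mod_cast hM
  have hd : 0 < (2 * (M : ℝ) - 1) := by linarith
  have hu := isUnit_det_listA_gram M hM hL
  have h1 : ((listA M hM)ᵀ * listA M hM) *ᵥ
      (((2 * M - 1) * Fintype.card (ListIdx M hM) / (M : ℝ)) • v) = v := by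
    rw [Matrix.mulVec_smul, listA_gram M hM hL, Matrix.add_mulVec, Matrix.smul_mulVec,
      Matrix.smul_mulVec, Matrix.one_mulVec]
    have h0 : (Matrix.of (fun _ _ => (1 : ℝ)) : Matrix (Fin (2 * M)) (Fin (2 * M)) ℝ) *ᵥ v = 0 := by
      ext j
      simp [Matrix.mulVec, dotProduct, hv]
    rw [h0, smul_zero, add_zero, smul_smul]
    convert one_smul ℝ v
    field_simp
  conv_lhs => rw [← h1, Matrix.mulVec_mulVec, Matrix.nonsing_inv_mul _ hu, Matrix.one_mulVec]

lemma listU_zero_add_one (M : ℕ) (hM : 0 < M) (p : Fin (2 * M) → ℝ) (hp1 : ∑ j, p j = 1)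
    (l : ListIdx M hM) : listU M hM p l 0 + listU M hM p l 1 = 1 := by
  simp [listU, Finset.sum_add_sum_compl, hp1]

lemma listA_mulVec_apply (M : ℕ) (hM : 0 < M) (p : Fin (2 * M) → ℝ) (l : ListIdx M hM)
    (b : Fin 2) :
    (listA M hM *ᵥ p) (l, b) = 1 / (Fintype.card (ListIdx M hM) : ℝ) * listU M hM p l b := by
  simp only [Matrix.mulVec, dotProduct, listA, Matrix.of_apply, listU, mul_assoc,
    ← Finset.mul_sum]
  congr 1
  by_cases hb : b = 0
  · simp [hb]
  · simp only [hb, if_false, ite_mul, zero_mul, one_mul]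
    rw [← Finset.sum_compl_add_sum l.1]
    rw [Finset.sum_congr rfl fun k hk => if_neg (Finset.mem_compl.1 hk),
      Finset.sum_congr (s₁ := l.1) rfl fun k hk => if_pos hk]
    simp

/-- The error of the list estimator is a signed sum of the centred yes-counts. -/
lemma listPhat_sub (M : ℕ) (hM : 0 < M) (hL : 0 < Fintype.card (ListIdx M hM))
    (p : Fin (2 * M) → ℝ) (hp1 : ∑ j, p j = 1) (n : ℕ) (hn : 0 < n) (nl : ListIdx M hM → ℕ)
    (hnl : ∀ l, (nl l : ℝ) = (n : ℝ) / (Fintype.card (ListIdx M hM) : ℝ))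
    (x : ListIdx M hM → Fin 2 → ℕ) (hx : ∀ l, x l 0 + x l 1 = nl l) (i : Fin (2 * M)) :
    listPhat M hM n x i - p i = ∑ l : ListIdx M hM, ((2 * (M : ℝ) - 1) / (n * M) *
      (if i ∈ l.1 then 1 else -1)) * ((x l 0 : ℝ) - nl l * listU M hM p l 0) := by
  have hL' : (0 : ℝ) < Fintype.card (ListIdx M hM) := by exact_mod_cast hL
  have hM' : (0 : ℝ) < M := by exact_mod_cast hM
  have hn' : (0 : ℝ) < n := by exact_mod_cast hn
  have hu := isUnit_det_listA_gram M hM hL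
  set A := listA M hM with hA
  set X : ListIdx M hM × Fin 2 → ℝ := fun lb => (x lb.1 lb.2 : ℝ) with hX
  set v : Fin (2 * M) → ℝ := Aᵀ *ᵥ (X - (n : ℝ) • (A *ᵥ p)) with hv
  have hvj : ∀ j, v j = ∑ l : ListIdx M hM, (1 / (Fintype.card (ListIdx M hM) : ℝ) *
      (if j ∈ l.1 then 1 else -1)) * ((x l 0 : ℝ) - nl l * listU M hM p l 0) := by
    intro j
    rw [hv, Matrix.mulVec, dotProduct, Fintype.sum_prod_type]
    refine Finset.sum_congr rfl fun l _ => ?_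
    have h1 := listU_zero_add_one M hM p hp1 l
    have h2 : (x l 0 : ℝ) + x l 1 = nl l := by exact_mod_cast hx l
    have h3 : ∀ b, (X - (n : ℝ) • (A *ᵥ p)) (l, b) = x l b - nl l * listU M hM p l b := by
      intro b
      simp only [Pi.sub_apply, Pi.smul_apply, hA, listA_mulVec_apply, hnl, hX, smul_eq_mul]
      ring
    have h4 : (x l 1 : ℝ) - nl l * listU M hM p l 1 = -(x l 0 - nl l * listU M hM p l 0) := by
      linear_combination h2 - (nl l : ℝ) * h1
    rw [Fin.sum_univ_two, h3, h3, h4]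
    by_cases hj : j ∈ l.1
    · simp [hA, listA, hj]
    · simp [hA, listA, hj]
      ring
  have hv0 : ∑ j, v j = 0 := by
    simp_rw [hvj]
    rw [Finset.sum_comm]
    refine Finset.sum_eq_zero fun l _ => ?_
    rw [← Finset.sum_mul, ← Finset.mul_sum]
    have hs : ∑ j, (if j ∈ l.1 then (1 : ℝ) else -1) = 0 := by
      have hc : (l.1ᶜ).card = M := by
        rw [Finset.card_compl, l.2.1, Fintype.card_fin]; omega
      rw [← Finset.sum_add_sum_compl l.1, Finset.sum_congr rfl fun k hk => if_pos hk,
        Finset.sum_congr (s₁ := l.1ᶜ) rfl fun k hk => if_neg (Finset.mem_compl.1 hk)]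
      simp [hc, l.2.1]
    rw [hs]
    ring
  have hmain : listPhat M hM n x - p = (1 / (n : ℝ)) • ((Aᵀ * A)⁻¹ *ᵥ v) := by
    have h5 : (Aᵀ * A)⁻¹ *ᵥ v = ((Aᵀ * A)⁻¹ * Aᵀ) *ᵥ X - (n : ℝ) • p := by
      rw [hv, Matrix.mulVec_mulVec, Matrix.mulVec_sub, Matrix.mulVec_smul, Matrix.mulVec_mulVec,
        Matrix.mul_assoc, Matrix.nonsing_inv_mul _ hu, Matrix.one_mulVec]
    rw [h5, smul_sub, smul_smul, one_div_mul_cancel hn'.ne', one_smul]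
    rfl
  have h6 := congrFun hmain i
  rw [hA, listA_gram_inv_mulVec M hM hL v hv0] at h6
  simp only [Pi.sub_apply, Pi.smul_apply, smul_eq_mul, hvj, Finset.mul_sum] at h6
  rw [h6]
  refine Finset.sum_congr rfl fun l _ => ?_
  field_simp

/-- for `N = 2M` even, in the balanced list design using all
`L = C(N−1, M−1)` lists of `M` parties containing party one (together with their
complementary lists), each with weight `α_l = 1/L`, all coordinates of the estimator
`p̂ = (1/n)(A'A)⁻¹ A' X̄` have the same variance, equal to
`(4/(nL)) (1 − 1/N)² Σ_l p_l⁺ p_l⁻`. -/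
theorem statement8 (M : ℕ) (hM : 0 < M)
    (p : Fin (2 * M) → ℝ) (hp0 : ∀ j, 0 ≤ p j) (hp1 : ∑ j, p j = 1)
    (n : ℕ) (hn : 0 < n) (nl : ListIdx M hM → ℕ)
    (hnl : ∀ l, (nl l : ℝ) = (n : ℝ) / (Fintype.card (ListIdx M hM) : ℝ))
    (hnsum : n = ∑ l, nl l) :
    ∀ i : Fin (2 * M),
      (∑' x : ListIdx M hM → Fin 2 → ℕ,
          (∏ l, multinomialPMF (nl l) (listU M hM p l) (x l)) *
            (listPhat M hM n x i - p i) ^ 2) =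
        4 / ((n : ℝ) * (Fintype.card (ListIdx M hM) : ℝ)) *
          (1 - 1 / (2 * (M : ℝ))) ^ 2 *
          ∑ l : ListIdx M hM, (∑ k ∈ l.1, p k) * (∑ k ∈ l.1ᶜ, p k) := by
  intro i
  have hL : 0 < Fintype.card (ListIdx M hM) := by
    rw [Fintype.card_pos_iff]
    by_contra h
    rw [not_nonempty_iff] at h
    simp at hnsum
    omega
  have hL' : (0 : ℝ) < Fintype.card (ListIdx M hM) := by exact_mod_cast hL
  have hM' : (0 : ℝ) < M := by exact_mod_cast hM
  have hn' : (0 : ℝ) < n := by exact_mod_cast hn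
  have hU := listU_zero_add_one M hM p hp1
  set c : ListIdx M hM → ℝ := fun l =>
    (2 * (M : ℝ) - 1) / (n * M) * (if i ∈ l.1 then 1 else -1) with hc
  have hc2 : ∀ l, c l ^ 2 = ((2 * (M : ℝ) - 1) / (n * M)) ^ 2 := by
    intro l
    by_cases hi : i ∈ l.1 <;> simp [hc, hi]
  rw [tsum_eq_sum (s := Fintype.piFinset fun l => Finset.Nat.antidiagonalTuple 2 (nl l))]
  · have hcongr : ∀ x ∈ Fintype.piFinset (fun l => Finset.Nat.antidiagonalTuple 2 (nl l)),
        (∏ l, multinomialPMF (nl l) (listU M hM p l) (x l)) * (listPhat M hM n x i - p i) ^ 2 =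
        (∏ l, multinomialPMF (nl l) (listU M hM p l) (x l)) *
          (∑ l, c l * ((x l 0 : ℝ) - nl l * listU M hM p l 0)) ^ 2 := by
      intro x hx
      rw [listPhat_sub M hM hL p hp1 n hn nl hnl x _ i]
      intro l
      simpa [Finset.Nat.mem_antidiagonalTuple] using Fintype.mem_piFinset.1 hx l
    rw [Finset.sum_congr rfl hcongr, sum_piFinset_prod_mul_sq_sum _
      (fun l y => multinomialPMF (nl l) (listU M hM p l) y)
      (fun l y => c l * ((y 0 : ℝ) - nl l * listU M hM p l 0))
      (fun l => c l ^ 2 * (nl l * (listU M hM p l 0 * listU M hM p l 1)))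
      (fun l => sum_multinomialPMF_two _ _ (hU l))]
    · rw [Finset.mul_sum]
      refine Finset.sum_congr rfl fun l _ => ?_
      rw [hc2, hnl]
      simp only [listU, if_true, one_ne_zero, if_false]
      field_simp
      ring
    · intro l
      simp_rw [mul_left_comm _ (c l)]
      rw [← Finset.mul_sum, sum_multinomialPMF_two_mul_sub _ _ (hU l), mul_zero]
    · intro l
      simp_rw [mul_pow, mul_left_comm _ (c l ^ 2)]
      rw [← Finset.mul_sum, sum_multinomialPMF_two_mul_sub_sq _ _ (hU l)]
  · intro x hx
    rw [Fintype.mem_piFinset, not_forall] at hx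
    obtain ⟨l, hl⟩ := hx
    rw [Finset.Nat.mem_antidiagonalTuple] at hl
    rw [Finset.prod_eq_zero (Finset.mem_univ l) (by simp only [multinomialPMF, if_neg hl]),
      zero_mul]
end

section
/- Let N ≥ 3, let B be the N × M incidence matrix of unordered pairs from {1,…,N} with M = N(N−1)/2, and let A := B'/(N−1). Then the matrix A^+ := ((N−1)/(N−2)) B − (1/(N−2)) J_{N,M} satisfies A^+ A = I_N; in particular A has full column rank N and A^+ is the Moore–Penrose pseudoinverse of A. -/
open Matrix

/-- The `N × (N(N−1)/2)` incidence matrix of unordered pairs: `B i k = 1` if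
element `i` belongs to the `k`-th pair and `0` otherwise. -/
def Bmat (N : ℕ) : Matrix (Fin N) (PairIdx N) ℝ :=
  Matrix.of fun i s => if i ∈ s.1 then 1 else 0

/-- The `m × n` all-ones real matrix `J`. -/
def Jmat (m n : Type*) : Matrix m n ℝ := Matrix.of fun _ _ => 1

theorem Bmat_mul_transpose_of_ne {N : ℕ} {i j : Fin N} (hij : i ≠ j) :
    (Bmat N * (Bmat N)ᵀ) i j = 1 := by
  have key : ∀ s : PairIdx N, (Bmat N i s) * ((Bmat N)ᵀ s j) =
      if s = ⟨{i, j}, Finset.card_pair hij⟩ then 1 else 0 := by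
    intro s
    have h : s = ⟨{i, j}, Finset.card_pair hij⟩ ↔ i ∈ s.1 ∧ j ∈ s.1 := by
      rw [Subtype.ext_iff]
      constructor
      · intro h
        simp [h]
      · rintro ⟨hi, hj⟩
        refine (Finset.eq_of_subset_of_card_le ?_ ?_).symm
        · simp [Finset.insert_subset_iff, hi, hj]
        · rw [s.2, Finset.card_pair hij]
    simp only [h, Bmat, Matrix.of_apply, Matrix.transpose_apply]
    split_ifs <;> simp_all
  rw [Matrix.mul_apply, Finset.sum_congr rfl fun s _ => key s]
  simp

theorem sum_Bmat_col {N : ℕ} (s : PairIdx N) : ∑ i, Bmat N i s = 2 := by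
  simp [Bmat, s.2]

theorem Bmat_mul_transpose_self {N : ℕ} (i : Fin N) :
    (Bmat N * (Bmat N)ᵀ) i i = ∑ s, Bmat N i s := by
  rw [Matrix.mul_apply]
  refine Finset.sum_congr rfl fun s _ => ?_
  simp [Bmat]

theorem sum_Bmat_row {N : ℕ} (i : Fin N) : ∑ s, Bmat N i s = (N : ℝ) - 1 := by
  have h₁ : ∑ j, (Bmat N * (Bmat N)ᵀ) i j = (∑ s, Bmat N i s) * 2 := by
    simp only [Matrix.mul_apply, Matrix.transpose_apply]
    rw [Finset.sum_comm, Finset.sum_mul]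
    simp only [← Finset.mul_sum, sum_Bmat_col]
  have h₂ : ∑ j, (Bmat N * (Bmat N)ᵀ) i j = ∑ s, Bmat N i s + ((N : ℝ) - 1) := by
    rw [← Finset.add_sum_erase _ _ (Finset.mem_univ i), Bmat_mul_transpose_self,
      Finset.sum_congr rfl fun j hj =>
        Bmat_mul_transpose_of_ne (Finset.ne_of_mem_erase hj).symm]
    simp [Finset.card_erase_of_mem, Nat.cast_sub (Fin.pos i)]
  linarith

theorem Jmat_mul_Bmat_transpose {N : ℕ} :
    Jmat (Fin N) (PairIdx N) * (Bmat N)ᵀ = ((N : ℝ) - 1) • Jmat (Fin N) (Fin N) := by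
  ext i j
  simp [Matrix.mul_apply, Jmat, sum_Bmat_row]

theorem Bmat_transpose_mul_Jmat {N : ℕ} :
    (Bmat N)ᵀ * Jmat (Fin N) (PairIdx N) = (2 : ℝ) • Jmat (PairIdx N) (PairIdx N) := by
  ext s t
  simp [Matrix.mul_apply, Jmat, sum_Bmat_col]

theorem Bmat_mul_transpose {N : ℕ} :
    Bmat N * (Bmat N)ᵀ = ((N : ℝ) - 2) • 1 + Jmat (Fin N) (Fin N) := by
  ext i j
  by_cases hij : i = j
  · subst hij
    rw [Bmat_mul_transpose_self, sum_Bmat_row]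
    simp [Jmat]
    ring
  · rw [Bmat_mul_transpose_of_ne hij]
    simp [Jmat, hij]

/-- for `N ≥ 3`, with `A := Bᵀ/(N−1)` the pair-method design matrix, the
matrix `A⁺ := ((N−1)/(N−2)) B − (1/(N−2)) J` satisfies `A⁺ A = I`; in particular `A` has
full column rank `N` and `A⁺` is the Moore–Penrose pseudoinverse of `A` (i.e. it
satisfies the four Penrose conditions). -/
theorem statement10 (N : ℕ) (hN : 3 ≤ N)
    (A : Matrix (PairIdx N) (Fin N) ℝ) (hA : A = (1 / ((N : ℝ) - 1)) • (Bmat N)ᵀ)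
    (Aplus : Matrix (Fin N) (PairIdx N) ℝ)
    (hAplus : Aplus = (((N : ℝ) - 1) / ((N : ℝ) - 2)) • Bmat N -
      (1 / ((N : ℝ) - 2)) • Jmat (Fin N) (PairIdx N)) :
    Aplus * A = 1 ∧
    A.rank = N ∧
    A * Aplus * A = A ∧
    Aplus * A * Aplus = Aplus ∧
    (A * Aplus)ᵀ = A * Aplus ∧
    (Aplus * A)ᵀ = Aplus * A := by
  have hN' : (3 : ℝ) ≤ N := by exact_mod_cast hN
  have h1 : (N : ℝ) - 1 ≠ 0 := by linarith
  have h2 : (N : ℝ) - 2 ≠ 0 := by linarith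
  have hinv : Aplus * A = 1 := by
    rw [hA, hAplus, Matrix.mul_smul, Matrix.sub_mul, Matrix.smul_mul, Matrix.smul_mul,
      Bmat_mul_transpose, Jmat_mul_Bmat_transpose]
    ext i j
    simp only [Matrix.smul_apply, Matrix.sub_apply, Matrix.add_apply, smul_eq_mul]
    field_simp
    ring
  have hsymm : (A * Aplus)ᵀ = A * Aplus := by
    have hJ : (Jmat (PairIdx N) (PairIdx N))ᵀ = Jmat (PairIdx N) (PairIdx N) := rfl
    rw [hA, hAplus, Matrix.smul_mul, Matrix.mul_sub, Matrix.mul_smul, Matrix.mul_smul,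
      Bmat_transpose_mul_Jmat]
    simp [Matrix.transpose_mul, hJ]
  have hrank : A.rank = N := by
    apply le_antisymm
    · simpa using A.rank_le_card_width
    · simpa [hinv] using Matrix.rank_mul_le_right Aplus A
  refine ⟨hinv, hrank, ?_, ?_, hsymm, ?_⟩
  · rw [Matrix.mul_assoc, hinv, Matrix.mul_one]
  · rw [hinv, Matrix.one_mul]
  · rw [hinv, Matrix.transpose_one]
end

section
/- Let N = 2M be even and p_i = 1/N for all i. In the balanced list method using all L = C(N−1, M−1) lists of size N/2 containing party one, each with weight α_l = 1/L, the covariance matrix of the estimator p̂ = (1/n)(A'A)^{-1} A' X̄ equals (1/n) M_N( (1 − 1/N)^2, −(1/N)(1 − 1/N) ); that is, Var[p̂_i] = (1/n)(1 − 1/N)^2 for every i and Cov[p̂_i, p̂_j] = −(1/(nN))(1 − 1/N) for all i ≠ j. -/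
open Matrix

/-- `M_N(a,b)`: the `N × N` real matrix with all diagonal entries `a` and all
off-diagonal entries `b`, i.e. `(a−b)·I + b·J`. -/
noncomputable def Mmat (n : ℕ) (a b : ℝ) : Matrix (Fin n) (Fin n) ℝ :=
  (a - b) • (1 : Matrix (Fin n) (Fin n) ℝ) + b • Jmat (Fin n) (Fin n)

/-- The `±1` membership sign of `i` in `s`. -/
noncomputable def memSign {α : Type*} [DecidableEq α] (s : Finset α) (i : α) : ℝ :=
  if i ∈ s then 1 else -1

section MemSign

variable {α : Type*} [DecidableEq α]

lemma memSign_mul_self (s : Finset α) (i : α) : memSign s i * memSign s i = 1 := by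
  unfold memSign; split_ifs <;> norm_num

lemma memSign_compl [Fintype α] (s : Finset α) (i : α) : memSign sᶜ i = -memSign s i := by
  unfold memSign; by_cases h : i ∈ s <;> simp [h]

lemma memSign_map_perm (σ : Equiv.Perm α) (s : Finset α) (i : α) :
    memSign (s.map σ.toEmbedding) i = memSign s (σ.symm i) := by
  unfold memSign; simp only [Finset.mem_map_equiv]

lemma sum_memSign [Fintype α] (s : Finset α) :
    ∑ i, memSign s i = 2 * (s.card : ℝ) - Fintype.card α := by
  have h : ∀ i, memSign s i = 2 * (if i ∈ s then 1 else 0) - 1 := fun i => by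
    unfold memSign; split_ifs <;> norm_num
  simp only [h, Finset.sum_sub_distrib, ← Finset.mul_sum]
  simp

lemma sum_powersetCard_memSign_mul_eq [Fintype α] (m : ℕ) {i j k : α} (hj : j ≠ i) (hk : k ≠ i) :
    ∑ s ∈ Finset.powersetCard m Finset.univ, memSign s i * memSign s j =
      ∑ s ∈ Finset.powersetCard m Finset.univ, memSign s i * memSign s k := by
  refine Finset.sum_equiv (Equiv.finsetCongr (Equiv.swap j k)) (fun s => ?_) (fun s _ => ?_)
  · simp [Finset.mem_powersetCard]
  · simp [Equiv.finsetCongr_apply, memSign_map_perm, Equiv.swap_apply_of_ne_of_ne hj.symm hk.symm]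

/-- Every half-size subset or its complement contains a given point, so sums of
complement-invariant functions over all half-size subsets double. -/
lemma sum_powersetCard_half_eq_two_mul [Fintype α] {m : ℕ} (hα : Fintype.card α = 2 * m) (a : α)
    (g : Finset α → ℝ) (hg : ∀ s, g sᶜ = g s) :
    ∑ s ∈ Finset.powersetCard m Finset.univ, g s =
      2 * ∑ s ∈ Finset.powersetCard m Finset.univ with a ∈ s, g s := by
  rw [← Finset.sum_filter_add_sum_filter_not _ (fun s => a ∈ s), two_mul]
  congr 1
  refine Finset.sum_nbij' compl compl ?_ ?_ ?_ ?_ ?_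
  · intro s; simp only [Finset.mem_filter, Finset.mem_powersetCard_univ, Finset.card_compl, hα,
      Finset.mem_compl]
    exact fun h => ⟨by omega, h.2⟩
  · intro s; simp only [Finset.mem_filter, Finset.mem_powersetCard_univ, Finset.card_compl, hα,
      Finset.mem_compl, not_not]
    exact fun h => ⟨by omega, h.2⟩
  · simp
  · simp
  · intro s _; exact (hg s).symm

end MemSign

lemma card_listIdx_pos (M : ℕ) (hM : 0 < M) : 0 < Fintype.card (ListIdx M hM) := by
  obtain ⟨s, hs, -, hc⟩ := Finset.exists_subsuperset_card_eq
    (Finset.subset_univ ({⟨0, by omega⟩} : Finset (Fin (2 * M)))) (n := M)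
    (by simp; omega) (by simp; omega)
  exact Fintype.card_pos_iff.2 ⟨⟨s, hc, hs (by simp)⟩⟩

lemma sum_listIdx (M : ℕ) (hM : 0 < M) (g : Finset (Fin (2 * M)) → ℝ) :
    ∑ l : ListIdx M hM, g l.1 =
      ∑ s ∈ Finset.powersetCard M Finset.univ with (⟨0, by omega⟩ : Fin (2 * M)) ∈ s, g s :=
  (Finset.sum_subtype _ (fun s => by simp [Finset.mem_powersetCard]) g).symm

lemma sum_listIdx_memSign_mul_of_ne (M : ℕ) (hM : 0 < M) {i j : Fin (2 * M)} (hij : i ≠ j) :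
    ∑ l : ListIdx M hM, memSign l.1 i * memSign l.1 j =
      -(Fintype.card (ListIdx M hM) : ℝ) / (2 * M - 1) := by
  have key : ∀ k, k ≠ i → ∑ l : ListIdx M hM, memSign l.1 i * memSign l.1 k =
      ∑ l : ListIdx M hM, memSign l.1 i * memSign l.1 j := fun k hk => by
    have h : ∀ k, ∑ s ∈ Finset.powersetCard M Finset.univ, memSign s i * memSign s k =
        2 * ∑ l : ListIdx M hM, memSign l.1 i * memSign l.1 k := fun k => by
      rw [sum_listIdx M hM fun s => memSign s i * memSign s k]
      exact sum_powersetCard_half_eq_two_mul (by simp) _ _ fun s => by simp [memSign_compl]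
    have := sum_powersetCard_memSign_mul_eq M hk hij.symm
    rw [h, h] at this
    linarith
  have htot : ∑ k, ∑ l : ListIdx M hM, memSign l.1 i * memSign l.1 k = 0 := by
    rw [Finset.sum_comm]
    refine Finset.sum_eq_zero fun l _ => ?_
    rw [← Finset.mul_sum, sum_memSign, l.2.1]
    simp
  rw [← Finset.add_sum_erase _ _ (Finset.mem_univ i),
    Finset.sum_congr rfl fun k hk => key k (Finset.ne_of_mem_erase hk)] at htot
  have h1 : (1 : ℝ) ≤ M := by exact_mod_cast hM
  simp only [memSign_mul_self, Finset.sum_const, Finset.card_erase_of_mem (Finset.mem_univ i),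
    Finset.card_univ, Fintype.card_fin, nsmul_eq_mul, mul_one] at htot
  rw [Nat.cast_sub (by omega)] at htot
  push_cast at htot
  rw [eq_div_iff (by linarith)]
  linarith

/-- Covariance of two linear combinations of independent centred variables, as finite sums. -/
lemma sum_piFinset_prod_mul_sum_mul_sum_s16 {ι β : Type*} [Fintype ι] [DecidableEq ι]
    (t : ι → Finset β) (f d : ι → β → ℝ) (v a b : ι → ℝ)
    (hf : ∀ l, ∑ y ∈ t l, f l y = 1) (hd : ∀ l, ∑ y ∈ t l, f l y * d l y = 0)
    (hv : ∀ l, ∑ y ∈ t l, f l y * d l y ^ 2 = v l) :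
    ∑ x ∈ Fintype.piFinset t, (∏ l, f l (x l)) *
        ((∑ l, a l * d l (x l)) * ∑ l, b l * d l (x l)) = ∑ l, a l * b l * v l := by
  have cov : ∀ l m, ∑ x ∈ Fintype.piFinset t, (∏ k, f k (x k)) * (d l (x l) * d m (x m)) =
      if l = m then v l else 0 := fun l m => by
    have h : ∀ x : ι → β, (∏ k, f k (x k)) * (d l (x l) * d m (x m)) =
        ∏ k, f k (x k) * ((if k = l then d k (x k) else 1) * if k = m then d k (x k) else 1) :=
      fun x => by
        rw [Finset.prod_mul_distrib, Finset.prod_mul_distrib]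
        simp
    simp only [h]
    rw [← Finset.prod_univ_sum t fun k y =>
      f k y * ((if k = l then d k y else 1) * if k = m then d k y else 1)]
    split_ifs with hlm
    · subst hlm
      rw [Finset.prod_eq_single l (fun k _ hk => by simp [hk, hf]) (by simp)]
      simp [← sq, hv]
    · exact Finset.prod_eq_zero (Finset.mem_univ l) (by simp [hlm, hd])
  calc _ = ∑ x ∈ Fintype.piFinset t, ∑ l, ∑ m, a l * b m *
        ((∏ k, f k (x k)) * (d l (x l) * d m (x m))) := by
        refine Finset.sum_congr rfl fun x _ => ?_
        rw [Finset.sum_mul_sum, Finset.mul_sum]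
        refine Finset.sum_congr rfl fun l _ => ?_
        rw [Finset.mul_sum]
        exact Finset.sum_congr rfl fun m _ => by ring
    _ = ∑ l, ∑ m, a l * b m * if l = m then v l else 0 := by
        rw [Finset.sum_comm]
        refine Finset.sum_congr rfl fun l _ => ?_
        rw [Finset.sum_comm]
        refine Finset.sum_congr rfl fun m _ => ?_
        rw [← Finset.mul_sum, cov]
    _ = _ := by simp

/-- The count vectors of two categories with total `n`. -/
def pairCounts (n : ℕ) : Finset (Fin 2 → ℕ) :=
  (Finset.range (n + 1)).image fun k => ![k, n - k]

lemma mem_pairCounts {n : ℕ} {y : Fin 2 → ℕ} : y ∈ pairCounts n ↔ ∑ i, y i = n := by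
  simp only [pairCounts, Finset.mem_image, Finset.mem_range, Fin.sum_univ_two]
  constructor
  · rintro ⟨k, hk, rfl⟩
    simp; omega
  · intro h
    refine ⟨y 0, by omega, ?_⟩
    ext i
    fin_cases i <;> simp; omega

lemma sum_multinomialPMF_half (n : ℕ) {u : Fin 2 → ℝ} (hu : ∀ b, u b = 1 / 2) (g : ℕ → ℝ) :
    ∑ y ∈ pairCounts n, multinomialPMF n u y * g (y 0) =
      ∑ k ∈ Finset.range (n + 1), g k * (bernsteinPolynomial ℝ n k).eval (1 / 2) := by
  rw [pairCounts, Finset.sum_image]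
  · refine Finset.sum_congr rfl fun k hk => ?_
    have hk : k ≤ n := by simpa [Nat.lt_succ_iff] using hk
    simp only [multinomialPMF, Fin.sum_univ_two, Fin.prod_univ_two, hu, bernsteinPolynomial]
    simp [Nat.cast_choose ℝ hk, hk]
    rw [show (1 - 2⁻¹ : ℝ) = 2⁻¹ by norm_num, inv_pow]
    ring
  · intro a _ b _ h
    simpa using congrFun h 0

lemma sum_multinomialPMF_half_eq_one (n : ℕ) {u : Fin 2 → ℝ} (hu : ∀ b, u b = 1 / 2) :
    ∑ y ∈ pairCounts n, multinomialPMF n u y = 1 := by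
  have h := congrArg (Polynomial.eval (1 / 2 : ℝ)) (bernsteinPolynomial.sum ℝ n)
  simpa [Polynomial.eval_finsetSum] using (sum_multinomialPMF_half n hu fun _ => 1).trans
    (by simpa [Polynomial.eval_finsetSum] using h)

lemma sum_multinomialPMF_half_mul_centered (n : ℕ) {u : Fin 2 → ℝ} (hu : ∀ b, u b = 1 / 2) :
    ∑ y ∈ pairCounts n, multinomialPMF n u y * ((y 0 : ℝ) - n / 2) = 0 := by
  have h := congrArg (Polynomial.eval (1 / 2 : ℝ)) (bernsteinPolynomial.sum_smul ℝ n)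
  have h1 := sum_multinomialPMF_half n hu fun k => (k : ℝ)
  simp only [Polynomial.eval_finsetSum, nsmul_eq_mul, Polynomial.eval_mul,
    Polynomial.eval_natCast, Polynomial.eval_X] at h
  simp only [mul_sub, Finset.sum_sub_distrib, ← Finset.sum_mul,
    sum_multinomialPMF_half_eq_one n hu, h1, h]
  ring

lemma sum_multinomialPMF_half_mul_centered_sq (n : ℕ) {u : Fin 2 → ℝ} (hu : ∀ b, u b = 1 / 2) :
    ∑ y ∈ pairCounts n, multinomialPMF n u y * ((y 0 : ℝ) - (n : ℝ) / 2) ^ 2 = (n : ℝ) / 4 := by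
  have h := congrArg (Polynomial.eval (1 / 2 : ℝ)) (bernsteinPolynomial.variance ℝ n)
  simp only [Polynomial.eval_finsetSum, nsmul_eq_mul, Polynomial.eval_mul, Polynomial.eval_pow,
    Polynomial.eval_sub, Polynomial.eval_natCast, Polynomial.eval_X, Polynomial.eval_one] at h
  rw [sum_multinomialPMF_half n hu fun k => ((k : ℝ) - n / 2) ^ 2]
  calc _ = _ := Finset.sum_congr rfl fun k _ => by ring
    _ = _ := h
    _ = _ := by ring

lemma listA_apply (M : ℕ) (hM : 0 < M) (l : ListIdx M hM) (b : Fin 2) (j : Fin (2 * M)) :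
    listA M hM (l, b) j = 1 / (Fintype.card (ListIdx M hM) : ℝ) *
      ((1 + (if b = 0 then 1 else -1) * memSign l.1 j) / 2) := by
  simp only [listA, memSign, Matrix.of_apply]
  split_ifs <;> norm_num

lemma listA_transpose_mul_self (M : ℕ) (hM : 0 < M) :
    (listA M hM)ᵀ * listA M hM = (1 / (Fintype.card (ListIdx M hM) : ℝ)) •
      Mmat (2 * M) 1 (((M : ℝ) - 1) / (2 * M - 1)) := by
  have hL : (Fintype.card (ListIdx M hM) : ℝ) ≠ 0 := by
    exact_mod_cast (card_listIdx_pos M hM).ne'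
  have h1 : (1 : ℝ) ≤ M := by exact_mod_cast hM
  have h2 : (2 * M - 1 : ℝ) ≠ 0 := by linarith
  ext i j
  have h : ((listA M hM)ᵀ * listA M hM) i j = (1 / (Fintype.card (ListIdx M hM) : ℝ)) ^ 2 *
      ((Fintype.card (ListIdx M hM) + ∑ l : ListIdx M hM, memSign l.1 i * memSign l.1 j) / 2) := by
    have hc : (Fintype.card (ListIdx M hM) : ℝ) = ∑ l : ListIdx M hM, 1 := by simp
    rw [Matrix.mul_apply, Fintype.sum_prod_type]
    simp only [Matrix.transpose_apply, listA_apply, Fin.sum_univ_two]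
    conv_rhs => rw [hc, ← Finset.sum_add_distrib, ← hc, Finset.sum_div, Finset.mul_sum]
    refine Finset.sum_congr rfl fun l _ => ?_
    simp
    ring
  rw [h]
  simp only [Mmat, Jmat, Matrix.smul_apply, Matrix.add_apply, Matrix.one_apply, Matrix.of_apply,
    smul_eq_mul]
  rcases eq_or_ne i j with rfl | hij
  · simp [memSign_mul_self]
    field_simp
  · rw [sum_listIdx_memSign_mul_of_ne M hM hij]
    simp [hij]
    field_simp
    ring

lemma Mmat_mul_Mmat (n : ℕ) (a b c d : ℝ) :
    Mmat n a b * Mmat n c d =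
      ((a - b) * (c - d)) • 1 + ((a - b) * d + b * (c - d) + n * b * d) • Jmat (Fin n) (Fin n) := by
  have hJ : Jmat (Fin n) (Fin n) * Jmat (Fin n) (Fin n) = (n : ℝ) • Jmat (Fin n) (Fin n) := by
    ext i j
    simp [Matrix.mul_apply, Jmat]
  simp only [Mmat, Matrix.add_mul, Matrix.mul_add, Matrix.smul_mul, Matrix.mul_smul, hJ, one_mul,
    mul_one, smul_smul]
  module

lemma inv_listA_transpose_mul_self (M : ℕ) (hM : 0 < M) :
    ((listA M hM)ᵀ * listA M hM)⁻¹ =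
      ((Fintype.card (ListIdx M hM) : ℝ) * ((2 * M - 1) / M)) •
        ((1 : Matrix (Fin (2 * M)) (Fin (2 * M)) ℝ) -
          (((M : ℝ) - 1) / (2 * M - 1) / M) • Jmat (Fin (2 * M)) (Fin (2 * M))) := by
  have hL : (Fintype.card (ListIdx M hM) : ℝ) ≠ 0 := by
    exact_mod_cast (card_listIdx_pos M hM).ne'
  have h1 : (1 : ℝ) ≤ M := by exact_mod_cast hM
  have h2 : (2 * M - 1 : ℝ) ≠ 0 := by linarith
  have h0 : (M : ℝ) ≠ 0 := by linarith
  set c : ℝ := ((M : ℝ) - 1) / (2 * M - 1) with hc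
  have hB : (1 : Matrix (Fin (2 * M)) (Fin (2 * M)) ℝ) - (c / M) • Jmat _ _ =
      Mmat (2 * M) (1 - c / M) (-(c / M)) := by
    simp only [Mmat]; module
  refine Matrix.inv_eq_right_inv ?_
  rw [listA_transpose_mul_self, hB, Matrix.smul_mul, Matrix.mul_smul, Mmat_mul_Mmat, ← hc,
    smul_add, smul_smul, smul_add, smul_smul, smul_smul, smul_smul]
  have e1 : (1 / (Fintype.card (ListIdx M hM) : ℝ)) *
      ((Fintype.card (ListIdx M hM) : ℝ) * ((2 * M - 1) / M) *
        ((1 - c) * (1 - c / M - -(c / M)))) = 1 := by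
    rw [hc]; field_simp; ring
  have e2 : (1 - c) * -(c / M) + c * (1 - c / M - -(c / M)) +
      ((2 * M : ℕ) : ℝ) * c * -(c / M) = 0 := by
    have hcM : c * (2 * M - 1) = M - 1 := by rw [hc, div_mul_cancel₀ _ h2]
    push_cast
    field_simp
    linear_combination -c * hcM
  rw [e1, e2]
  simp

/-- Shape of the estimator on count vectors with the prescribed totals. -/
lemma listPhat_sub_uniform (M : ℕ) (hM : 0 < M) {n : ℕ} (hn : 0 < n) {nl : ListIdx M hM → ℕ}
    (hnsum : n = ∑ l, nl l) {x : ListIdx M hM → Fin 2 → ℕ} (hx : ∀ l, ∑ b, x l b = nl l)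
    (i : Fin (2 * M)) :
    listPhat M hM n x i - 1 / (2 * (M : ℝ)) =
      ∑ l, (2 * M - 1) / (M * n) * memSign l.1 i * ((x l 0 : ℝ) - nl l / 2) := by
  have hL : (Fintype.card (ListIdx M hM) : ℝ) ≠ 0 := by
    exact_mod_cast (card_listIdx_pos M hM).ne'
  have h1 : (1 : ℝ) ≤ M := by exact_mod_cast hM
  have h2 : (2 * M - 1 : ℝ) ≠ 0 := by linarith
  have h0 : (M : ℝ) ≠ 0 := by linarith
  have hn0 : (n : ℝ) ≠ 0 := by exact_mod_cast hn.ne'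
  set Z : Fin (2 * M) → ℝ := fun i => ∑ l, memSign l.1 i * ((x l 0 : ℝ) - nl l / 2) with hZ
  have hw : ((listA M hM)ᵀ *ᵥ fun lb => (x lb.1 lb.2 : ℝ)) =
      fun i => 1 / (Fintype.card (ListIdx M hM) : ℝ) * (n / 2 + Z i) := by
    ext i
    have hn' : (n : ℝ) = ∑ l, (nl l : ℝ) := by exact_mod_cast hnsum
    simp only [Matrix.mulVec, dotProduct, Fintype.sum_prod_type, Matrix.transpose_apply,
      listA_apply, Fin.sum_univ_two, hZ]
    rw [hn', Finset.sum_div, ← Finset.sum_add_distrib, Finset.mul_sum]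
    refine Finset.sum_congr rfl fun l _ => ?_
    have hxl : (x l 1 : ℝ) = nl l - x l 0 := by
      rw [← hx l, Fin.sum_univ_two]; push_cast; ring
    simp [hxl]
    ring
  have hZ0 : ∑ i, Z i = 0 := by
    simp only [hZ]
    rw [Finset.sum_comm]
    refine Finset.sum_eq_zero fun l _ => ?_
    rw [← Finset.sum_mul, sum_memSign, l.2.1]
    simp
  have hJ : ∀ w : Fin (2 * M) → ℝ, (Jmat (Fin (2 * M)) (Fin (2 * M)) *ᵥ w) i = ∑ k, w k :=
    fun w => by simp [Matrix.mulVec, dotProduct, Jmat]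
  have hR : ∑ l, (2 * M - 1) / (M * n) * memSign l.1 i * ((x l 0 : ℝ) - nl l / 2) =
      (2 * M - 1) / (M * n) * Z i := by
    rw [hZ, Finset.mul_sum]
    exact Finset.sum_congr rfl fun l _ => by ring
  rw [hR, listPhat, Pi.smul_apply, ← Matrix.mulVec_mulVec, hw, inv_listA_transpose_mul_self,
    Matrix.smul_mulVec, Pi.smul_apply, Matrix.sub_mulVec, Pi.sub_apply, Matrix.one_mulVec,
    Matrix.smul_mulVec, Pi.smul_apply, hJ, ← Finset.mul_sum, Finset.sum_add_distrib, hZ0]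
  simp only [Finset.sum_const, Finset.card_univ, Fintype.card_fin, nsmul_eq_mul, smul_eq_mul]
  push_cast
  field_simp
  ring

lemma listU_uniform (M : ℕ) (hM : 0 < M) {p : Fin (2 * M) → ℝ}
    (hp : ∀ j, p j = 1 / (2 * (M : ℝ))) (l : ListIdx M hM) (b : Fin 2) :
    listU M hM p l b = 1 / 2 := by
  have h0 : (M : ℝ) ≠ 0 := by exact_mod_cast hM.ne'
  have hc : (l.1ᶜ).card = M := by
    rw [Finset.card_compl, l.2.1, Fintype.card_fin]; omega
  simp only [listU, hp, Finset.sum_const, hc, l.2.1, nsmul_eq_mul, ite_self]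
  field_simp

/-- for `N = 2M` even and uniform preferences `p_i = 1/N`, in the balanced
list design using all `L = C(N−1, M−1)` lists of size `N/2` containing party one, each
with weight `1/L`, the covariance matrix of `p̂ = (1/n)(A'A)⁻¹ A' X̄` equals
`(1/n) M_N((1 − 1/N)², −(1/N)(1 − 1/N))`; i.e. `Var[p̂_i] = (1/n)(1 − 1/N)²` for all `i`
and `Cov[p̂_i, p̂_j] = −(1/(nN))(1 − 1/N)` for all `i ≠ j`. -/
theorem statement16 (M : ℕ) (hM : 0 < M)
    (p : Fin (2 * M) → ℝ) (hp : ∀ j, p j = 1 / (2 * (M : ℝ)))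
    (n : ℕ) (hn : 0 < n) (nl : ListIdx M hM → ℕ)
    (hnl : ∀ l, (nl l : ℝ) = (n : ℝ) / (Fintype.card (ListIdx M hM) : ℝ))
    (hnsum : n = ∑ l, nl l) :
    ∀ i j : Fin (2 * M),
      (∑' x : ListIdx M hM → Fin 2 → ℕ,
          (∏ l, multinomialPMF (nl l) (listU M hM p l) (x l)) *
            ((listPhat M hM n x i - p i) * (listPhat M hM n x j - p j))) =
        ((1 / (n : ℝ)) •
            Mmat (2 * M) ((1 - 1 / (2 * (M : ℝ))) ^ 2)
              (-(1 / (2 * (M : ℝ))) * (1 - 1 / (2 * (M : ℝ))))) i j := by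
  intro i j
  have hL : (Fintype.card (ListIdx M hM) : ℝ) ≠ 0 := by
    exact_mod_cast (card_listIdx_pos M hM).ne'
  have h1 : (1 : ℝ) ≤ M := by exact_mod_cast hM
  have h2 : (2 * M - 1 : ℝ) ≠ 0 := by linarith
  have h0 : (M : ℝ) ≠ 0 := by linarith
  have hn0 : (n : ℝ) ≠ 0 := by exact_mod_cast hn.ne'
  rw [tsum_eq_sum (s := Fintype.piFinset fun l => pairCounts (nl l)) fun x hx => ?_]
  swap
  · simp only [Fintype.mem_piFinset, mem_pairCounts, not_forall] at hx
    obtain ⟨l, hl⟩ := hx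
    rw [Finset.prod_eq_zero (Finset.mem_univ l) (by simp only [multinomialPMF, if_neg hl]),
      zero_mul]
  rw [Finset.sum_congr rfl fun x hx => by
    have hx' : ∀ l, ∑ b, x l b = nl l := fun l =>
      mem_pairCounts.1 (Fintype.mem_piFinset.1 hx l)
    rw [hp, hp, listPhat_sub_uniform M hM hn hnsum hx', listPhat_sub_uniform M hM hn hnsum hx']]
  have hu := listU_uniform M hM hp
  rw [sum_piFinset_prod_mul_sum_mul_sum_s16 (fun l => pairCounts (nl l))
    (fun l => multinomialPMF (nl l) (listU M hM p l)) (fun l y => (y 0 : ℝ) - nl l / 2)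
    (fun l => (nl l : ℝ) / 4) _ _ (fun l => sum_multinomialPMF_half_eq_one _ (hu l))
    (fun l => sum_multinomialPMF_half_mul_centered _ (hu l))
    (fun l => sum_multinomialPMF_half_mul_centered_sq _ (hu l))]
  have hsum : ∑ l : ListIdx M hM, (2 * (M : ℝ) - 1) / (M * n) * memSign l.1 i *
      ((2 * M - 1) / (M * n) * memSign l.1 j) * ((nl l : ℝ) / 4) =
      ((2 * M - 1) / (M * n)) ^ 2 * (n / Fintype.card (ListIdx M hM) / 4) *
        ∑ l : ListIdx M hM, memSign l.1 i * memSign l.1 j := by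
    rw [Finset.mul_sum]
    exact Finset.sum_congr rfl fun l _ => by rw [hnl]; ring
  rw [hsum]
  simp only [Mmat, Jmat, Matrix.smul_apply, Matrix.add_apply, Matrix.one_apply, Matrix.of_apply,
    smul_eq_mul]
  rcases eq_or_ne i j with rfl | hij
  · simp only [memSign_mul_self, Finset.sum_const, Finset.card_univ, nsmul_eq_mul, if_true]
    field_simp
    ring
  · rw [sum_listIdx_memSign_mul_of_ne M hM hij, if_neg hij]
    field_simp
    ring
end

section
/- In the pair method with N ≥ 3 parties and true preference probabilities p_1,…,p_N (all positive, summing to 1), let T be the true preference of a random respondent and R her reported unordered pair. Then the mutual information satisfies I[T;R] = −Σ_{i ≠ j} (p_i/(N−1)) log₂(p_i + p_j), and the conditional entropy satisfies H[T|R] = −Σ_{i ≠ j} (p_i/(N−1)) log₂( p_i/(p_i + p_j) ). In particular, when p_i = 1/N for all i, I[T;R] = log₂ N − 1 and H[T|R] = 1. -/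
/-- A sum over unordered pairs of a function vanishing off the pairs containing `i` is a sum over
the other element of the pair. -/
theorem sum_pairIdx_of_mem {N : ℕ} (i : Fin N) (g : PairIdx N → ℝ) (f : Fin N → ℝ)
    (h0 : ∀ s : PairIdx N, i ∉ s.1 → g s = 0)
    (h : ∀ j (hij : i ≠ j), g ⟨{i, j}, Finset.card_pair hij⟩ = f j) :
    ∑ s, g s = ∑ j ∈ ({i}ᶜ : Finset (Fin N)), f j := by
  have hfilter : ∑ s, g s = ∑ s with i ∈ s.1, g s :=
    (Finset.sum_filter_of_ne fun s _ hs => not_imp_comm.1 (h0 s) hs).symm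
  have ne_of_mem {j : Fin N} (hj : j ∈ ({i}ᶜ : Finset (Fin N))) : i ≠ j := by
    rintro rfl
    simp at hj
  rw [hfilter]
  symm
  refine Finset.sum_bij (fun j hj => ⟨{i, j}, Finset.card_pair (ne_of_mem hj)⟩) ?_ ?_ ?_ ?_
  · intro j hj
    simp
  · intro a ha b hb hab
    have hmem : a ∈ ({i, b} : Finset (Fin N)) := by
      rw [← Subtype.mk.inj hab]
      simp
    rcases Finset.mem_insert.1 hmem with rfl | hmem
    · exact absurd rfl (ne_of_mem ha)
    · exact Finset.mem_singleton.1 hmem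
  · rintro ⟨s, hs⟩ his
    have his : i ∈ s := by simpa using his
    obtain ⟨a, b, hab, rfl⟩ := Finset.card_eq_two.1 hs
    rcases Finset.mem_insert.1 his with rfl | hib
    · exact ⟨b, by simpa using hab.symm, rfl⟩
    · obtain rfl := Finset.mem_singleton.1 hib
      exact ⟨a, by simpa using hab, Subtype.ext (Finset.pair_comm _ _)⟩
  · intro j hj
    exact (h j (ne_of_mem hj)).symm

/-- in the pair method with `N ≥ 3` parties and positive preference
probabilities `p` summing to `1`, with `T` the true preference and `R` the reported
unordered pair (joint law `P(T=i, R={i,j}) = p_i/(N−1)`), the mutual information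
`I[T;R] = H[T] − H[T|R]` satisfies `I[T;R] = −Σ_{i≠j} (p_i/(N−1)) log₂(p_i + p_j)` and
the conditional entropy satisfies
`H[T|R] = −Σ_{i≠j} (p_i/(N−1)) log₂(p_i/(p_i + p_j))`. In particular, if `p_i = 1/N`
for all `i`, then `I[T;R] = log₂ N − 1` and `H[T|R] = 1`. -/
theorem statement17 (N : ℕ) (hN : 3 ≤ N)
    (p : Fin N → ℝ) (hp0 : ∀ i, 0 < p i) (hp1 : ∑ i, p i = 1)
    (joint : Fin N × PairIdx N → ℝ)
    (hjoint : ∀ i s, joint (i, s) = if i ∈ s.1 then p i / ((N : ℝ) - 1) else 0)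
    (HT HTgR : ℝ)
    (hHT : HT = -∑ i, p i * Real.logb 2 (p i))
    (hHTgR : HTgR = -∑ i, ∑ s : PairIdx N,
      joint (i, s) * Real.logb 2 (joint (i, s) / ∑ i', joint (i', s))) :
    (HT - HTgR =
        -∑ i, ∑ j ∈ ({i}ᶜ : Finset (Fin N)), p i / ((N : ℝ) - 1) * Real.logb 2 (p i + p j)) ∧
    (HTgR =
        -∑ i, ∑ j ∈ ({i}ᶜ : Finset (Fin N)),
          p i / ((N : ℝ) - 1) * Real.logb 2 (p i / (p i + p j))) ∧
    ((∀ i, p i = 1 / (N : ℝ)) →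
      HT - HTgR = Real.logb 2 (N : ℝ) - 1 ∧ HTgR = 1) := by
  have hN1 : (0 : ℝ) < (N : ℝ) - 1 := by
    have : (3 : ℝ) ≤ N := by exact_mod_cast hN
    linarith
  have hcard (i : Fin N) : ((({i}ᶜ : Finset (Fin N)).card : ℕ) : ℝ) = (N : ℝ) - 1 := by
    rw [Finset.card_compl, Finset.card_singleton, Fintype.card_fin, Nat.cast_sub (by lia),
      Nat.cast_one]
  have hmarg (i j : Fin N) (hij : i ≠ j) :
      ∑ i', joint (i', ⟨{i, j}, Finset.card_pair hij⟩) = (p i + p j) / ((N : ℝ) - 1) := by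
    simp only [hjoint]
    rw [← Finset.sum_filter, Finset.filter_mem_eq_inter, Finset.univ_inter,
      Finset.sum_pair hij, add_div]
  have hcond : HTgR = -∑ i, ∑ j ∈ ({i}ᶜ : Finset (Fin N)),
      p i / ((N : ℝ) - 1) * Real.logb 2 (p i / (p i + p j)) := by
    rw [hHTgR]
    congr 1
    refine Finset.sum_congr rfl fun i _ => sum_pairIdx_of_mem i _ _ ?_ ?_
    · intro s hs
      simp [hjoint, hs]
    · intro j hij
      rw [hmarg i j hij, hjoint, if_pos (Finset.mem_insert_self i {j}),
        div_div_div_cancel_right₀ hN1.ne']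
  have hmutual : HT - HTgR = -∑ i, ∑ j ∈ ({i}ᶜ : Finset (Fin N)),
      p i / ((N : ℝ) - 1) * Real.logb 2 (p i + p j) := by
    have hrow (i : Fin N) : p i * Real.logb 2 (p i) = ∑ j ∈ ({i}ᶜ : Finset (Fin N)),
        p i / ((N : ℝ) - 1) * Real.logb 2 (p i) := by
      rw [Finset.sum_const, nsmul_eq_mul, hcard]
      field_simp
    rw [hHT, hcond, sub_neg_eq_add, neg_add_eq_sub, ← neg_sub, neg_inj,
      ← Finset.sum_sub_distrib]
    refine Finset.sum_congr rfl fun i _ => ?_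
    rw [hrow, ← Finset.sum_sub_distrib]
    refine Finset.sum_congr rfl fun j _ => ?_
    rw [Real.logb_div (hp0 i).ne' (add_pos (hp0 i) (hp0 j)).ne']
    ring
  refine ⟨hmutual, hcond, fun hunif => ?_⟩
  have hN0 : (0 : ℝ) < N := by linarith
  have hone : HTgR = 1 := by
    have hhalf : (1 / (N : ℝ)) / (1 / N + 1 / N) = 2⁻¹ := by
      field_simp
      norm_num
    rw [hcond]
    simp only [hunif, hhalf, Real.logb_inv, Real.logb_self_eq_one one_lt_two, Finset.sum_const,
      nsmul_eq_mul, hcard, Finset.card_univ, Fintype.card_fin]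
    field_simp
  refine ⟨?_, hone⟩
  rw [hone, hHT]
  simp only [hunif, one_div, Real.logb_inv, Finset.sum_const, nsmul_eq_mul, Finset.card_univ,
    Fintype.card_fin]
  field_simp
end

section
/- In the list method with lists 𝔏_1^+,…,𝔏_L^+ shown with probabilities α_1,…,α_L (α_l > 0, Σ α_l = 1), let T be the true preference of a random respondent (with probabilities p_1,…,p_N, all positive) and let R record which list was shown together with the yes/no answer. Then I[T;R] = −Σ_{l=1}^{L} α_l ( p_l^+ log₂ p_l^+ + p_l^− log₂ p_l^− ), where p_l^± := Σ_{k ∈ 𝔏_l^±} p_k. In particular, if p_l^+ = p_l^− = 1/2 for every l, then I[T;R] = 1. -/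
/-- The entropy of a positive weight restricted to `S`, relative to its total mass on `S`. -/
lemma sum_mul_logb_div_sum {ι : Type*} (b : ℝ) (p : ι → ℝ) (hp : ∀ i, 0 < p i) (S : Finset ι)
    {a : ℝ} (ha : a ≠ 0) :
    ∑ i ∈ S, p i * a * Real.logb b (p i * a / ∑ j ∈ S, p j * a) =
      a * (∑ i ∈ S, p i * Real.logb b (p i) -
        (∑ i ∈ S, p i) * Real.logb b (∑ i ∈ S, p i)) := by
  rw [Finset.sum_mul, ← Finset.sum_sub_distrib, Finset.mul_sum]
  refine Finset.sum_congr rfl fun i hi => ?_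
  have hS : 0 < ∑ j ∈ S, p j := Finset.sum_pos (fun j _ => hp j) ⟨i, hi⟩
  rw [← Finset.sum_mul, mul_div_mul_right _ _ ha, Real.logb_div (hp i).ne' hS.ne']
  ring

/-- in the list method with lists `𝔏_1⁺,…,𝔏_L⁺` shown with probabilities
`α_1,…,α_L` (`α_l > 0`, `Σ α_l = 1`), true preference `T` with positive probabilities
`p_1,…,p_N` summing to `1`, and response `R` recording the list shown together with the
yes/no answer (joint law `P(T=i, R=(l, yes)) = p_i α_l` if `i ∈ 𝔏_l⁺`, and
`P(T=i, R=(l, no)) = p_i α_l` if `i ∈ 𝔏_l⁻`), the mutual information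
`I[T;R] = H[T] − H[T|R]` satisfies
`I[T;R] = −Σ_l α_l (p_l⁺ log₂ p_l⁺ + p_l⁻ log₂ p_l⁻)`, where `p_l^± = Σ_{k ∈ 𝔏_l^±} p_k`.
In particular, if `p_l⁺ = p_l⁻ = 1/2` for every `l`, then `I[T;R] = 1`. -/
theorem statement18 (N L : ℕ)
    (p : Fin N → ℝ) (hp0 : ∀ i, 0 < p i) (hp1 : ∑ i, p i = 1)
    (𝔏 : Fin L → Finset (Fin N))
    (α : Fin L → ℝ) (hα0 : ∀ l, 0 < α l) (hα1 : ∑ l, α l = 1)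
    (joint : Fin N × (Fin L × Bool) → ℝ)
    (hjoint : ∀ i l b,
      joint (i, (l, b)) = if (i ∈ 𝔏 l) = (b = true) then p i * α l else 0)
    (HT HTgR : ℝ)
    (hHT : HT = -∑ i, p i * Real.logb 2 (p i))
    (hHTgR : HTgR = -∑ i, ∑ l, ∑ b : Bool,
      joint (i, (l, b)) * Real.logb 2 (joint (i, (l, b)) / ∑ i', joint (i', (l, b)))) :
    (HT - HTgR =
        -∑ l, α l *
          ((∑ k ∈ 𝔏 l, p k) * Real.logb 2 (∑ k ∈ 𝔏 l, p k) +
            (∑ k ∈ (𝔏 l)ᶜ, p k) * Real.logb 2 (∑ k ∈ (𝔏 l)ᶜ, p k))) ∧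
    ((∀ l, (∑ k ∈ 𝔏 l, p k) = 1 / 2 ∧ (∑ k ∈ (𝔏 l)ᶜ, p k) = 1 / 2) →
      HT - HTgR = 1) := by
  have htrue : ∀ i l, joint (i, (l, true)) = if i ∈ 𝔏 l then p i * α l else 0 := by
    intro i l
    rw [hjoint]
    exact if_congr (by simp) rfl rfl
  have hfalse : ∀ i l, joint (i, (l, false)) = if i ∈ (𝔏 l)ᶜ then p i * α l else 0 := by
    intro i l
    rw [hjoint]
    exact if_congr (by simp) rfl rfl
  have hcond : ∀ l, ∑ b : Bool, ∑ i,
      joint (i, (l, b)) * Real.logb 2 (joint (i, (l, b)) / ∑ i', joint (i', (l, b))) =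
      α l * ∑ i, p i * Real.logb 2 (p i) - α l *
          ((∑ k ∈ 𝔏 l, p k) * Real.logb 2 (∑ k ∈ 𝔏 l, p k) +
            (∑ k ∈ (𝔏 l)ᶜ, p k) * Real.logb 2 (∑ k ∈ (𝔏 l)ᶜ, p k)) := by
    intro l
    have hite : ∀ (S : Finset (Fin N)),
        ∑ i, (if i ∈ S then p i * α l else 0) * Real.logb 2
          ((if i ∈ S then p i * α l else 0) / ∑ j, if j ∈ S then p j * α l else 0) =
        ∑ i ∈ S, p i * α l * Real.logb 2 (p i * α l / ∑ j ∈ S, p j * α l) := by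
      intro S
      rw [Finset.sum_ite_mem, Finset.univ_inter]
      refine (Finset.sum_subset_zero_on_sdiff (Finset.subset_univ S) ?_ ?_).symm
      · intro i hi
        simp [(Finset.mem_sdiff.mp hi).2]
      · intro i hi
        simp [hi]
    simp only [Fintype.sum_bool, htrue, hfalse]
    rw [hite, hite, sum_mul_logb_div_sum 2 p hp0 _ (hα0 l).ne',
      sum_mul_logb_div_sum 2 p hp0 _ (hα0 l).ne',
      ← Finset.sum_add_sum_compl (𝔏 l) fun i => p i * Real.logb 2 (p i)]
    ring
  have hmain : HT - HTgR =
      -∑ l, α l *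
        ((∑ k ∈ 𝔏 l, p k) * Real.logb 2 (∑ k ∈ 𝔏 l, p k) +
          (∑ k ∈ (𝔏 l)ᶜ, p k) * Real.logb 2 (∑ k ∈ (𝔏 l)ᶜ, p k)) := by
    rw [hHT, hHTgR, Finset.sum_comm, Finset.sum_congr rfl fun l _ =>
      Finset.sum_comm.trans (hcond l), Finset.sum_sub_distrib, ← Finset.sum_mul, hα1]
    ring
  refine ⟨hmain, fun h => ?_⟩
  have hlog : Real.logb 2 (1 / 2) = -1 := by
    rw [one_div, Real.logb_inv, Real.logb_self_eq_one one_lt_two]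
  rw [hmain, Finset.sum_congr rfl fun l _ => by rw [(h l).1, (h l).2, hlog],
    ← Finset.sum_mul, hα1]
  norm_num
end
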